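/- arXiv:1212.6843 — 11 statements merged into one kernel-verified Lean document; each statement's English description precedes it below -/
import Mathlib

section
/- Let X be a real Hilbert space, let K_1, …, K_r ⊆ X be nonempty closed convex sets with K := ⋂_{l=1}^r K_l ≠ ∅, and let x_0 ∈ X. Suppose the sequences (x_i)_{i≥0}, (x_i^{(j)}) are generated by the best-approximation algorithm with full projections: for every i ≥ 1 and every j ∈ {1,…,r}, x_i^{(j)} = P_{K_j}(x_{i−1}), a_i^{(j)} = x_{i−1} − x_i^{(j)}, b_i^{(j)} = ⟪a_i^{(j)}, x_i^{(j)}⟫, F_i = {x ∈ X : ⟪a_l^{(j)}, x⟫ ≤ b_l^{(j)} for all 1 ≤ l ≤ i and 1 ≤ j ≤ r}, and x_i = P_{F_i}(x_0). Then the sequence (x_i) converges strongly (in norm) to P_K(x_0). -/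
open scoped RealInnerProductSpace
open Filter Topology

/-- If the angle at `y` between `x0` and `z` is obtuse, then the Pythagorean inequality holds. -/
lemma norm_sub_sq_le_of_inner_nonpos {X : Type*} [NormedAddCommGroup X] [InnerProductSpace ℝ X]
    {x0 y z : X} (h : ⟪x0 - y, z - y⟫ ≤ 0) :
    ‖z - y‖ ^ 2 ≤ ‖z - x0‖ ^ 2 - ‖y - x0‖ ^ 2 := by
  have h1 := norm_sub_sq_real (z - y) (x0 - y)
  rw [sub_sub_sub_cancel_right, real_inner_comm, norm_sub_rev x0 y] at h1
  linarith

/-- A half-space through `q` with normal `y - q` that contains `z` is at distance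
at most `‖y - z‖` from `y`. -/
lemma norm_sub_le_of_inner_le {X : Type*} [NormedAddCommGroup X] [InnerProductSpace ℝ X]
    {y q z : X} (h : ⟪y - q, z⟫ ≤ ⟪y - q, q⟫) : ‖y - q‖ ≤ ‖y - z‖ := by
  have h1 : ⟪y - q, z - q⟫ ≤ 0 := by rw [inner_sub_right]; linarith
  have h2 : ⟪y - q, y - q⟫ = ⟪y - q, y - z⟫ + ⟪y - q, z - q⟫ := by
    rw [← inner_add_right, sub_add_sub_cancel]
  rw [real_inner_self_eq_norm_sq] at h2
  have h3 := real_inner_le_norm (y - q) (y - z)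
  by_contra! h4
  nlinarith [norm_nonneg (y - z)]

/-- A sequence whose squared increments are dominated by the increments of a bounded real
sequence is Cauchy. -/
lemma cauchySeq_of_norm_sub_sq_le {X : Type*} [NormedAddCommGroup X] {x : ℕ → X} {d : ℕ → ℝ}
    {B : ℝ} (hB : ∀ n, d n ≤ B) (h : ∀ m n, m ≤ n → ‖x n - x m‖ ^ 2 ≤ d n - d m) :
    CauchySeq x := by
  have hmono : Monotone d := fun m n hmn => by
    linarith [h m n hmn, sq_nonneg ‖x n - x m‖]
  have hbdd : BddAbove (Set.range d) := ⟨B, by rintro _ ⟨n, rfl⟩; exact hB n⟩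
  have hd : CauchySeq d := (tendsto_atTop_ciSup hmono hbdd).cauchySeq
  rw [Metric.cauchySeq_iff'] at hd ⊢
  intro ε hε
  obtain ⟨N, hN⟩ := hd (ε ^ 2) (by positivity)
  refine ⟨N, fun n hn => ?_⟩
  have h1 := (abs_lt.1 (Real.dist_eq (d n) (d N) ▸ hN n hn)).2
  rw [dist_eq_norm]
  exact lt_of_pow_lt_pow_left₀ 2 hε.le ((h N n hn).trans_lt h1)

/-- Strong convergence of the best-approximation algorithm with
full projections (Algorithm 3.1 with (3.2b)) to the projection of `x0` onto
`K = ⋂ l K l` in a real Hilbert space. -/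
theorem strong_convergence_best_approximation
    {X : Type*} [NormedAddCommGroup X] [InnerProductSpace ℝ X] [CompleteSpace X]
    {r : ℕ} (hr : 1 ≤ r)
    (K : Fin r → Set X)
    (hKne : ∀ j, (K j).Nonempty) (hKcl : ∀ j, IsClosed (K j))
    (hKcv : ∀ j, Convex ℝ (K j))
    (hK : (⋂ j, K j).Nonempty)
    (x0 : X) (x : ℕ → X) (xp : ℕ → Fin r → X)
    (hx0 : x 0 = x0)
    -- `xp i j` is the metric projection of `x (i-1)` onto `K j`
    (hproj : ∀ i, 1 ≤ i → ∀ j, xp i j ∈ K j ∧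
      ∀ z ∈ K j, ⟪x (i - 1) - xp i j, z - xp i j⟫ ≤ 0)
    -- `x i` is the metric projection of `x0` onto
    -- `F i = {y | ⟪a l j, y⟫ ≤ b l j for all 1 ≤ l ≤ i, j}`
    (hxF : ∀ i, 1 ≤ i →
      (∀ l, 1 ≤ l → l ≤ i → ∀ j,
        ⟪x (l - 1) - xp l j, x i⟫ ≤ ⟪x (l - 1) - xp l j, xp l j⟫) ∧
      ∀ z : X, (∀ l, 1 ≤ l → l ≤ i → ∀ j,
          ⟪x (l - 1) - xp l j, z⟫ ≤ ⟪x (l - 1) - xp l j, xp l j⟫) →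
        ⟪x0 - x i, z - x i⟫ ≤ 0)
    -- `p` is the metric projection of `x0` onto `K`
    (p : X) (hpK : p ∈ ⋂ j, K j)
    (hp : ∀ z ∈ ⋂ j, K j, ⟪x0 - p, z - p⟫ ≤ 0) :
    Tendsto x atTop (𝓝 p) := by
  have hmem : ∀ l, 1 ≤ l → ∀ j,
      ⟪x (l - 1) - xp l j, p⟫ ≤ ⟪x (l - 1) - xp l j, xp l j⟫ := by
    intro l hl j
    have h := (hproj l hl j).2 p (Set.mem_iInter.1 hpK j)
    rw [inner_sub_right] at h
    linarith
  have hobt : ∀ m z, (∀ l, 1 ≤ l → l ≤ m → ∀ j,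
      ⟪x (l - 1) - xp l j, z⟫ ≤ ⟪x (l - 1) - xp l j, xp l j⟫) →
      ‖z - x m‖ ^ 2 ≤ ‖z - x0‖ ^ 2 - ‖x m - x0‖ ^ 2 := by
    intro m z hz
    apply norm_sub_sq_le_of_inner_nonpos
    rcases Nat.eq_zero_or_pos m with rfl | hm
    · simp [hx0]
    · exact (hxF m hm).2 z hz
  have hbound : ∀ n, ‖x n - x0‖ ^ 2 ≤ ‖p - x0‖ ^ 2 := by
    intro n
    linarith [hobt n p fun l hl _ => hmem l hl, sq_nonneg ‖p - x n‖]
  have hcauchy : CauchySeq x := by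
    refine cauchySeq_of_norm_sub_sq_le hbound fun m n hmn => hobt m (x n) ?_
    intro l hl hlm
    exact (hxF n (by omega)).1 l hl (hlm.trans hmn)
  obtain ⟨q, hq⟩ := cauchySeq_tendsto_of_complete hcauchy
  have hq1 : Tendsto (fun n => x (n + 1)) atTop (𝓝 q) := hq.comp (tendsto_add_atTop_nat 1)
  have hqK : q ∈ ⋂ j, K j := by
    refine Set.mem_iInter.2 fun j => ?_
    have hz : Tendsto (fun n => x n - xp (n + 1) j) atTop (𝓝 0) := by
      have hstep : Tendsto (fun n => ‖x n - x (n + 1)‖) atTop (𝓝 0) := by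
        simpa using (hq.sub hq1).norm
      refine squeeze_zero_norm (fun n => ?_) hstep
      exact norm_sub_le_of_inner_le ((hxF (n + 1) (by omega)).1 (n + 1) (by omega) le_rfl j)
    have hxp : Tendsto (fun n => xp (n + 1) j) atTop (𝓝 q) := by
      simpa using hq.sub hz
    exact (hKcl j).mem_of_tendsto hxp
      (Eventually.of_forall fun n => (hproj (n + 1) (by omega) j).1)
  have hqle : ‖q - x0‖ ^ 2 ≤ ‖p - x0‖ ^ 2 :=
    le_of_tendsto' ((hq.sub_const x0).norm.pow 2) hbound
  have hqp : ‖q - p‖ ^ 2 ≤ 0 := by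
    linarith [norm_sub_sq_le_of_inner_nonpos (hp q hqK)]
  have heq : q = p := by
    rw [← sub_eq_zero, ← norm_eq_zero]
    exact pow_eq_zero_iff two_ne_zero |>.1 (le_antisymm hqp (sq_nonneg _))
  exact heq ▸ hq
end

section
/- Let K_1, …, K_r ⊆ ℝⁿ be nonempty closed convex sets with K := ⋂_{l=1}^r K_l ≠ ∅, let x_0 ∈ ℝⁿ, and let x̄ = P_K(x_0). Let (x_i) be generated by the best-approximation algorithm with full projections: for i ≥ 1 and j ∈ {1,…,r}, x_i^{(j)} = P_{K_j}(x_{i−1}), a_i^{(j)} = x_{i−1} − x_i^{(j)}, b_i^{(j)} = ⟪a_i^{(j)}, x_i^{(j)}⟫, F_i = {x : ⟪a_l^{(j)}, x⟫ ≤ b_l^{(j)} for all 1 ≤ l ≤ i, 1 ≤ j ≤ r}, x_i = P_{F_i}(x_0). Assume there exists ε̄ > 0 such that (K_j − x̄) ∩ B̄_ε̄(0) = T_{K_j}(x̄) ∩ B̄_ε̄(0) for every j = 1,…,r, and that x_0 − x̄ lies in the interior of N_K(x̄). Then the algorithm converges in finitely many iterations: there exists N such that x_i = x̄ for all i ≥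 N. -/
open scoped RealInnerProductSpace
open Filter Topology

/-- The normal cone of a convex set `C` at a point `x ∈ C`. -/
def normalCone {E : Type*} [NormedAddCommGroup E] [InnerProductSpace ℝ E]
    (C : Set E) (x : E) : Set E :=
  {v | ∀ y ∈ C, ⟪v, y - x⟫ ≤ 0}

/-- The tangent cone of a convex set `C` at a point `x̄ ∈ C`:
`closure (⋃_{t>0} t • (C - x̄))`. -/
def tangentConeCvx {E : Type*} [NormedAddCommGroup E] [InnerProductSpace ℝ E]
    (C : Set E) (x : E) : Set E :=
  closure {w | ∃ t : ℝ, 0 < t ∧ ∃ c ∈ C, w = t • (c - x)}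

section Outer

variable {E ι : Type*} [NormedAddCommGroup E] [InnerProductSpace ℝ E]

/-- If `p` lies between `x` and `y` in the sense that `⟪x - p, y - p⟫ ≤ 0`, then it is no farther
from `x` than `y` is. -/
theorem norm_sub_le_of_inner_nonpos {x y p : E} (h : ⟪x - p, y - p⟫ ≤ 0) :
    ‖x - p‖ ≤ ‖x - y‖ := by
  have h1 := norm_sub_sq_real (x - p) (y - p)
  rw [sub_sub_sub_cancel_right] at h1
  refine le_of_sq_le_sq ?_ (norm_nonneg _)
  nlinarith [sq_nonneg ‖y - p‖]

/-- The outer-approximation iterates converge to the projection of the starting point. -/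
theorem tendsto_outer_approximation [CompleteSpace E] {K : ι → Set E}
    (hKcl : ∀ j, IsClosed (K j)) {x0 xbar : E} {x : ℕ → E} {p : ℕ → ι → E}
    (hpK : ∀ i j, p i j ∈ K j)
    (hp : ∀ i j, ∀ z ∈ K j, ⟪x i - p i j, z - p i j⟫ ≤ 0)
    (hfeas : ∀ l i, l < i → ∀ j, ⟪x l - p l j, x i - p l j⟫ ≤ 0)
    (hopt : ∀ i z, (∀ l < i, ∀ j, ⟪x l - p l j, z - p l j⟫ ≤ 0) → ⟪x0 - x i, z - x i⟫ ≤ 0)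
    (hxb : xbar ∈ ⋂ j, K j) (hxbproj : ∀ z ∈ ⋂ j, K j, ⟪x0 - xbar, z - xbar⟫ ≤ 0) :
    Tendsto x atTop (𝓝 xbar) ∧ ∀ j, Tendsto (fun i => p i j) atTop (𝓝 xbar) := by
  have hpyth : ∀ i z, ⟪x0 - x i, z - x i⟫ ≤ 0 → ‖x i - z‖ ^ 2 ≤ ‖x0 - z‖ ^ 2 - ‖x0 - x i‖ ^ 2 := by
    intro i z h
    have h1 := norm_sub_sq_real (x0 - x i) (z - x i)
    rw [sub_sub_sub_cancel_right] at h1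
    rw [norm_sub_rev (x i) z]
    linarith
  have hstep : ∀ i m, i ≤ m → ‖x i - x m‖ ^ 2 ≤ ‖x0 - x m‖ ^ 2 - ‖x0 - x i‖ ^ 2 := fun i m him =>
    hpyth i _ (hopt i _ fun l hl j => hfeas l m (hl.trans_le him) j)
  have hmono : Monotone fun i => ‖x0 - x i‖ ^ 2 := fun i m him => by
    have := hstep i m him
    have := sq_nonneg ‖x i - x m‖
    dsimp only
    linarith
  have hbd : ∀ i, ‖x0 - x i‖ ^ 2 ≤ ‖x0 - xbar‖ ^ 2 := fun i => by
    have := hpyth i xbar (hopt i _ fun l _ j => hp l j _ (Set.mem_iInter.1 hxb j))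
    linarith [sq_nonneg ‖x i - xbar‖]
  have hlim := tendsto_atTop_ciSup hmono ⟨_, Set.forall_mem_range.2 hbd⟩
  set c := ⨆ i, ‖x0 - x i‖ ^ 2
  have hc : ∀ i, ‖x0 - x i‖ ^ 2 ≤ c := hmono.ge_of_tendsto hlim
  have hcauchy : CauchySeq x := by
    refine cauchySeq_of_le_tendsto_0' (fun i => √(c - ‖x0 - x i‖ ^ 2)) (fun i m him => ?_) ?_
    · rw [dist_eq_norm]
      exact Real.le_sqrt_of_sq_le ((hstep i m him).trans (by linarith [hc m]))
    · simpa using ((tendsto_const_nhds (x := c)).sub hlim).sqrt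
  obtain ⟨y, hy⟩ := cauchySeq_tendsto_of_complete hcauchy
  have hpy : ∀ j, Tendsto (fun i => p i j) atTop (𝓝 y) := by
    intro j
    have h0 : Tendsto (fun i => ‖x i - x (i + 1)‖) atTop (𝓝 0) := by
      simpa using (hy.sub (hy.comp (tendsto_add_atTop_nat 1))).norm
    have h1 : Tendsto (fun i => x i - p i j) atTop (𝓝 0) :=
      squeeze_zero_norm (fun i => norm_sub_le_of_inner_nonpos (hfeas i (i + 1) i.lt_succ_self j)) h0
    simpa using hy.sub h1
  have hyK : y ∈ ⋂ j, K j := Set.mem_iInter.2 fun j =>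
    (hKcl j).mem_of_tendsto (hpy j) (Eventually.of_forall fun i => hpK i j)
  have hyx : y = xbar := by
    have h1 : ‖x0 - y‖ ^ 2 ≤ ‖x0 - xbar‖ ^ 2 :=
      le_of_tendsto ((tendsto_const_nhds.sub hy).norm.pow 2) (Eventually.of_forall hbd)
    have h2 := norm_sub_sq_real (x0 - xbar) (y - xbar)
    rw [sub_sub_sub_cancel_right] at h2
    have h3 := hxbproj y hyK
    have h4 : ‖y - xbar‖ ^ 2 ≤ 0 := by linarith
    rw [← sub_eq_zero, ← norm_eq_zero]
    exact pow_eq_zero_iff two_ne_zero |>.1 (le_antisymm h4 (sq_nonneg _))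
  subst hyx
  exact ⟨hy, hpy⟩

/-- The tangent cone is closed under positive scaling. -/
theorem smul_mem_tangentConeCvx {C : Set E} {x w : E} {t : ℝ} (ht : 0 < t)
    (hw : w ∈ tangentConeCvx C x) : t • w ∈ tangentConeCvx C x := by
  refine map_mem_closure (continuous_const_smul t) hw ?_
  rintro _ ⟨s, hs, c, hc, rfl⟩
  exact ⟨t * s, mul_pos ht hs, c, hc, smul_smul _ _ _⟩

theorem sub_mem_tangentConeCvx {C : Set E} {x c : E} (hc : c ∈ C) :
    c - x ∈ tangentConeCvx C x :=
  subset_closure ⟨1, one_pos, c, hc, (one_smul _ _).symm⟩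

theorem add_mem_of_mem_tangentConeCvx {C : Set E} {x w : E} {ε : ℝ}
    (hC : ((· - x) '' C) ∩ Metric.closedBall 0 ε = tangentConeCvx C x ∩ Metric.closedBall 0 ε)
    (hw : w ∈ tangentConeCvx C x) (hwε : ‖w‖ ≤ ε) : x + w ∈ C := by
  have hw' : w ∈ ((· - x) '' C) ∩ Metric.closedBall 0 ε :=
    hC ▸ ⟨hw, mem_closedBall_zero_iff.2 hwε⟩
  obtain ⟨⟨c, hc, rfl⟩, -⟩ := hw'
  simpa using hc

/-- Near the apex of a locally conical set, the residual of a projection is orthogonal to the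
projection seen from the apex. -/
theorem inner_residual_eq_zero_of_conical {C : Set E} {x y p : E} {ε : ℝ}
    (hC : ((· - x) '' C) ∩ Metric.closedBall 0 ε = tangentConeCvx C x ∩ Metric.closedBall 0 ε)
    (hx : x ∈ C) (hpC : p ∈ C) (hp : ∀ z ∈ C, ⟪y - p, z - p⟫ ≤ 0) (hpε : ‖p - x‖ ≤ ε / 2) :
    ⟪y - p, p - x⟫ = 0 := by
  have h1 := hp _ (add_mem_of_mem_tangentConeCvx hC
    (smul_mem_tangentConeCvx two_pos (sub_mem_tangentConeCvx hpC))
    (by rw [norm_smul, Real.norm_two]; linarith))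
  have h2 := hp x hx
  rw [show x + (2 : ℝ) • (p - x) - p = p - x by module] at h1
  rw [← neg_sub p x, inner_neg_right] at h2
  linarith

/-- An interior point of the normal cone at `x` makes a strictly obtuse angle with every nonzero
feasible direction. -/
theorem inner_neg_of_mem_interior_normalCone {C : Set E} {x v w : E} {t : ℝ} (ht : 0 < t)
    (hv : v ∈ interior (normalCone C x)) (hw : w ≠ 0) (hwC : x + t • w ∈ C) : ⟪v, w⟫ < 0 := by
  have hcont : Tendsto (fun s : ℝ => v + s • w) (𝓝[>] 0) (𝓝 v) := by
    have : Continuous fun s : ℝ => v + s • w := by fun_prop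
    simpa using (this.tendsto 0).mono_left nhdsWithin_le_nhds
  obtain ⟨s, hs, hs0⟩ := ((hcont.eventually (mem_interior_iff_mem_nhds.1 hv)).and
    self_mem_nhdsWithin).exists
  have h := hs _ hwC
  rw [add_sub_cancel_left, inner_smul_right, inner_add_left, real_inner_smul_left,
    real_inner_self_eq_norm_sq] at h
  have hw2 : 0 < s * ‖w‖ ^ 2 := mul_pos hs0 (by positivity)
  have := nonpos_of_mul_nonpos_right h ht
  linarith

/-- The outer-approximation iterates reach the projection of the starting point after finitely many
steps when the sets are locally conical there and the normal cone condition holds. -/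
theorem finite_convergence_outer_approximation [FiniteDimensional ℝ E] [Finite ι] {K : ι → Set E}
    (hKcl : ∀ j, IsClosed (K j)) {x0 xbar : E} {x : ℕ → E} {p : ℕ → ι → E}
    (hpK : ∀ i j, p i j ∈ K j)
    (hp : ∀ i j, ∀ z ∈ K j, ⟪x i - p i j, z - p i j⟫ ≤ 0)
    (hfeas : ∀ l i, l < i → ∀ j, ⟪x l - p l j, x i - p l j⟫ ≤ 0)
    (hopt : ∀ i z, (∀ l < i, ∀ j, ⟪x l - p l j, z - p l j⟫ ≤ 0) → ⟪x0 - x i, z - x i⟫ ≤ 0)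
    (hxb : xbar ∈ ⋂ j, K j) (hxbproj : ∀ z ∈ ⋂ j, K j, ⟪x0 - xbar, z - xbar⟫ ≤ 0)
    {ε : ℝ} (hε : 0 < ε)
    (hcone : ∀ j, ((· - xbar) '' K j) ∩ Metric.closedBall 0 ε =
      tangentConeCvx (K j) xbar ∩ Metric.closedBall 0 ε)
    (hnormal : x0 - xbar ∈ interior (normalCone (⋂ j, K j) xbar)) :
    ∃ N : ℕ, ∀ i ≥ N, x i = xbar := by
  have : CompleteSpace E := FiniteDimensional.complete ℝ E
  have : ProperSpace E := FiniteDimensional.proper ℝ E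
  obtain ⟨hx, hpx⟩ := tendsto_outer_approximation hKcl hpK hp hfeas hopt hxb hxbproj
  by_contra! hne
  have hxbj := Set.mem_iInter.1 hxb
  have hxb_feas : ∀ i, ⟪x0 - x i, xbar - x i⟫ ≤ 0 := fun i =>
    hopt i _ fun l _ j => hp l j _ (hxbj j)
  have horth : ∀ᶠ l in atTop, ∀ j, ⟪x l - p l j, p l j - xbar⟫ = 0 := by
    refine eventually_all.2 fun j => ?_
    filter_upwards [(hpx j).eventually (Metric.closedBall_mem_nhds xbar (half_pos hε))] with l hl
    rw [dist_eq_norm] at hl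
    exact inner_residual_eq_zero_of_conical (hcone j) (hxbj j) (hpK l j) (hp l j) hl
  obtain ⟨f, hf, hfne⟩ := extraction_of_frequently_atTop (frequently_atTop.2 hne)
  set d : ℕ → E := fun k => ‖x (f k) - xbar‖⁻¹ • (x (f k) - xbar) with hd
  have hpos : ∀ k, 0 < ‖x (f k) - xbar‖ := fun k => norm_pos_iff.2 (sub_ne_zero.2 (hfne k))
  have hd1 : ∀ k, d k ∈ Metric.sphere (0 : E) 1 := fun k => by
    rw [mem_sphere_zero_iff_norm, hd, norm_smul, norm_inv, norm_norm,
      inv_mul_cancel₀ (hpos k).ne']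
  obtain ⟨u, hu1, g, hg, hgu⟩ := (isCompact_sphere (0 : E) 1).tendsto_subseq hd1
  have hfg : Tendsto (fun k => f (g k)) atTop atTop := (hf.comp hg).tendsto_atTop
  have hu_ne : u ≠ 0 := by
    rintro rfl
    simp at hu1
  have hcut : ∀ᶠ l in atTop, ∀ j, ⟪x l - p l j, u⟫ ≤ 0 := by
    filter_upwards [horth] with l hl j
    refine le_of_tendsto (tendsto_const_nhds.inner hgu) ?_
    filter_upwards [hfg.eventually_gt_atTop l] with k hk
    have h1 := hfeas l _ hk j
    have h2 := hl j
    have h3 : ⟪x l - p l j, x (f (g k)) - xbar⟫ ≤ 0 := by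
      rw [← sub_add_sub_cancel (x (f (g k))) (p l j) xbar, inner_add_right]
      linarith
    simp only [Function.comp_apply, hd, inner_smul_right]
    exact mul_nonpos_of_nonneg_of_nonpos (inv_nonneg.2 (norm_nonneg _)) h3
  have huT : ∀ j, u ∈ tangentConeCvx (K j) xbar := by
    intro j
    set w : ℕ → E := fun k => ‖x (f (g k)) - xbar‖⁻¹ • (p (f (g k)) j - xbar) with hw
    have hdw : Tendsto (fun k => d (g k) - w k) atTop (𝓝 0) := by
      refine squeeze_zero_norm' ?_ (tendsto_iff_norm_sub_tendsto_zero.1 hgu)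
      filter_upwards [hfg.eventually hcut, hfg.eventually horth] with k hk1 hk2
      have hdiff : d (g k) - w k = ‖x (f (g k)) - xbar‖⁻¹ • (x (f (g k)) - p (f (g k)) j) := by
        simp only [hd, hw]
        module
      have hin : ⟪d (g k) - w k, u - w k⟫ ≤ 0 := by
        rw [hdiff, real_inner_smul_left]
        refine mul_nonpos_of_nonneg_of_nonpos (inv_nonneg.2 (norm_nonneg _)) ?_
        simp only [hw]
        rw [inner_sub_right, inner_smul_right, hk2 j]
        simpa using hk1 j
      exact norm_sub_le_of_inner_nonpos hin
    have hwu : Tendsto w atTop (𝓝 u) := by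
      simpa using hgu.sub hdw
    refine isClosed_closure.mem_of_tendsto hwu (Eventually.of_forall fun k => ?_)
    exact smul_mem_tangentConeCvx (inv_pos.2 (hpos _)) (sub_mem_tangentConeCvx (hpK _ j))
  have hlt : ⟪x0 - xbar, u⟫ < 0 := by
    refine inner_neg_of_mem_interior_normalCone hε hnormal hu_ne (Set.mem_iInter.2 fun j => ?_)
    refine add_mem_of_mem_tangentConeCvx (hcone j) (smul_mem_tangentConeCvx hε (huT j)) ?_
    rw [norm_smul, mem_sphere_zero_iff_norm.1 hu1, mul_one, Real.norm_of_nonneg hε.le]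
  have hge : 0 ≤ ⟪x0 - xbar, u⟫ := by
    refine ge_of_tendsto ((tendsto_const_nhds.sub (hx.comp hfg)).inner hgu)
      (Eventually.of_forall fun k => ?_)
    have h := hxb_feas (f (g k))
    rw [← neg_sub (x _) xbar, inner_neg_right, neg_nonpos] at h
    simp only [Function.comp_apply, hd, inner_smul_right]
    exact mul_nonneg (inv_nonneg.2 (norm_nonneg _)) h
  exact hlt.not_ge hge

end Outer

/-- Finite convergence of the best-approximation algorithm with full
projections in `ℝⁿ`, when the sets are locally conical at `x̄ = P_K(x0)` and
`x0 - x̄` lies in the interior of the normal cone `N_K(x̄)`. -/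
theorem finite_convergence_best_approximation_conical
    {n : ℕ} {r : ℕ} (hr : 1 ≤ r)
    (K : Fin r → Set (EuclideanSpace ℝ (Fin n)))
    (hKne : ∀ j, (K j).Nonempty) (hKcl : ∀ j, IsClosed (K j))
    (hKcv : ∀ j, Convex ℝ (K j))
    (hK : (⋂ j, K j).Nonempty)
    (x0 : EuclideanSpace ℝ (Fin n))
    (x : ℕ → EuclideanSpace ℝ (Fin n))
    (xp : ℕ → Fin r → EuclideanSpace ℝ (Fin n))
    (hx0 : x 0 = x0)
    -- `xp i j` is the metric projection of `x (i-1)` onto `K j`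
    (hproj : ∀ i, 1 ≤ i → ∀ j, xp i j ∈ K j ∧
      ∀ z ∈ K j, ⟪x (i - 1) - xp i j, z - xp i j⟫ ≤ 0)
    -- `x i` is the metric projection of `x0` onto `F i`
    (hxF : ∀ i, 1 ≤ i →
      (∀ l, 1 ≤ l → l ≤ i → ∀ j,
        ⟪x (l - 1) - xp l j, x i⟫ ≤ ⟪x (l - 1) - xp l j, xp l j⟫) ∧
      ∀ z : EuclideanSpace ℝ (Fin n),
        (∀ l, 1 ≤ l → l ≤ i → ∀ j,
          ⟪x (l - 1) - xp l j, z⟫ ≤ ⟪x (l - 1) - xp l j, xp l j⟫) →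
        ⟪x0 - x i, z - x i⟫ ≤ 0)
    -- `x̄` is the metric projection of `x0` onto `K`
    (xbar : EuclideanSpace ℝ (Fin n)) (hxbK : xbar ∈ ⋂ j, K j)
    (hxbproj : ∀ z ∈ ⋂ j, K j, ⟪x0 - xbar, z - xbar⟫ ≤ 0)
    -- local conic structure: `(K_j - x̄) ∩ B̄_ε̄(0) = T_{K_j}(x̄) ∩ B̄_ε̄(0)`
    (εbar : ℝ) (hεbar : 0 < εbar)
    (hcone : ∀ j, ((· - xbar) '' K j) ∩ Metric.closedBall 0 εbar =
      tangentConeCvx (K j) xbar ∩ Metric.closedBall 0 εbar)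
    -- normal condition: `x0 - x̄ ∈ int N_K(x̄)`
    (hnormal : x0 - xbar ∈ interior (normalCone (⋂ j, K j) xbar)) :
    ∃ N : ℕ, ∀ i ≥ N, x i = xbar := by
  have hfeas : ∀ l i, l < i → ∀ j, ⟪x l - xp (l + 1) j, x i - xp (l + 1) j⟫ ≤ 0 := by
    intro l i hli j
    have h := (hxF i (Nat.one_le_of_lt hli)).1 (l + 1) (Nat.le_add_left 1 l) hli j
    rw [Nat.add_sub_cancel] at h
    rw [inner_sub_right]
    linarith
  refine finite_convergence_outer_approximation (p := fun i => xp (i + 1)) hKcl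
    (fun i j => (hproj (i + 1) (Nat.le_add_left 1 i) j).1)
    (fun i j => by simpa using (hproj (i + 1) (Nat.le_add_left 1 i) j).2)
    hfeas (fun i z hz => ?_) hxbK hxbproj hεbar hcone hnormal
  rcases Nat.eq_zero_or_pos i with rfl | hi
  · simp [hx0]
  · refine (hxF i hi).2 z fun l hl hli j => ?_
    have h := hz (l - 1) (by omega) j
    rw [Nat.sub_add_cancel hl, inner_sub_right] at h
    linarith
end

section
/- Let X be a real Hilbert space and K_1, K_2 ⊆ X nonempty closed convex sets with K := K_1 ∩ K_2 ≠ ∅, and let x_0 ∈ X. Suppose (x_i) is generated by the modified alternating projection algorithm with simultaneous projections: for i ≥ 1 and j = 1, 2, x_i^{(j)} = P_{K_j}(x_{i−1}), a_i^{(j)} = x_{i−1} − x_i^{(j)}, b_i^{(j)} = ⟪a_i^{(j)}, x_i^{(j)}⟫, F_i = {x ∈ X : ⟪a_i^{(j)}, x⟫ ≤ b_i^{(j)} for j = 1, 2}, and x_i = P_{F_i}(x_{i−1}). Then there exists z ∈ K such that x_i converges weakly to z, i.e. ⟪x_i, y⟫ → ⟪z, y⟫ for every y ∈ X. If moreover the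 interior of K is nonempty, then x_i converges to z in norm. -/
open scoped RealInnerProductSpace
open Filter Topology

/-- A norm-bounded family in a Hilbert space converges weakly along every ultrafilter. -/
lemma exists_weak_limit_ultrafilter {ι X : Type*} [NormedAddCommGroup X] [InnerProductSpace ℝ X]
    [CompleteSpace X] (U : Ultrafilter ι) (x : ι → X) (M : ℝ) (hM : ∀ i, ‖x i‖ ≤ M) :
    ∃ w : X, ∀ y : X, Tendsto (fun i => ⟪x i, y⟫) U (𝓝 ⟪w, y⟫) := by
  let f : ι → WeakDual ℝ X := fun i => StrongDual.toWeakDual (InnerProductSpace.toDual ℝ X (x i))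
  have hmem : ∀ i, f i ∈ WeakDual.toStrongDual ⁻¹' Metric.closedBall (0 : StrongDual ℝ X) M :=
    fun i => mem_closedBall_zero_iff.2
      (((InnerProductSpace.toDual ℝ X).norm_map (x i)).trans_le (hM i))
  have hle : Tendsto f U
      (𝓟 (WeakDual.toStrongDual ⁻¹' Metric.closedBall (0 : StrongDual ℝ X) M)) :=
    tendsto_principal.2 (Eventually.of_forall hmem)
  obtain ⟨g, -, hg⟩ :=
    (WeakDual.isCompact_closedBall (𝕜 := ℝ) (E := X) 0 M).ultrafilter_le_nhds (U.map f) hle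
  refine ⟨(InnerProductSpace.toDual ℝ X).symm (WeakDual.toStrongDual g), fun y => ?_⟩
  rw [InnerProductSpace.toDual_symm_apply]
  have hf : Tendsto f U (𝓝 g) := hg
  exact ((WeakDual.eval_continuous y).tendsto g).comp hf

/-- **Opial's lemma**: a sequence converges weakly to a point of `C` as soon as its distance to
each point of the nonempty set `C` converges and all its weak cluster points lie in `C`. -/
lemma exists_weak_limit_of_tendsto_norm_sub {X : Type*} [NormedAddCommGroup X]
    [InnerProductSpace ℝ X] [CompleteSpace X] (C : Set X) (x : ℕ → X) (M : ℝ)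
    (hM : ∀ i, ‖x i‖ ≤ M)
    (hdist : ∀ c ∈ C, ∃ l : ℝ, Tendsto (fun i => ‖x i - c‖ ^ 2) atTop (𝓝 l))
    (hcluster : ∀ (U : Ultrafilter ℕ) (w : X), (U : Filter ℕ) ≤ atTop →
      (∀ y, Tendsto (fun i => ⟪x i, y⟫) U (𝓝 ⟪w, y⟫)) → w ∈ C) :
    ∃ z ∈ C, ∀ y : X, Tendsto (fun i => ⟪x i, y⟫) atTop (𝓝 ⟪z, y⟫) := by
  obtain ⟨z, hz⟩ := exists_weak_limit_ultrafilter (Ultrafilter.of atTop) x M hM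
  have hzC := hcluster _ z (Ultrafilter.of_le _) hz
  refine ⟨z, hzC, fun y => (tendsto_iff_ultrafilter _ _ _).2 fun V hV => ?_⟩
  obtain ⟨w, hw⟩ := exists_weak_limit_ultrafilter V x M hM
  have hwC := hcluster V w hV hw
  obtain ⟨l, hl⟩ := hdist z hzC
  obtain ⟨m, hm⟩ := hdist w hwC
  have hlim : Tendsto (fun i => ⟪x i, w - z⟫) atTop
      (𝓝 ((l - m - ‖z‖ ^ 2 + ‖w‖ ^ 2) / 2)) := by
    refine ((((hl.sub hm).sub_const _).add_const _).div_const 2).congr fun i => ?_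
    rw [norm_sub_sq_real, norm_sub_sq_real, inner_sub_right]
    ring
  have hwz : ⟪w - z, w - z⟫ = 0 := by
    rw [inner_sub_left, sub_eq_zero]
    exact (tendsto_nhds_unique (hw _) (hlim.mono_left hV)).trans
      (tendsto_nhds_unique (hz _) (hlim.mono_left (Ultrafilter.of_le _))).symm
  rw [inner_self_eq_zero, sub_eq_zero] at hwz
  exact hwz ▸ hw y

/-- If `x - p` tends to zero in norm with `p` in a closed convex set `C`, then weak limits of `x`
belong to `C`. -/
lemma mem_of_weak_limit_of_tendsto_sub {ι X : Type*} [NormedAddCommGroup X]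
    [InnerProductSpace ℝ X] [CompleteSpace X] {C : Set X} (hcl : IsClosed C) (hcv : Convex ℝ C)
    (hne : C.Nonempty) {l : Filter ι} [l.NeBot] {x p : ι → X} {w : X} (hp : ∀ i, p i ∈ C)
    (hxp : Tendsto (fun i => x i - p i) l (𝓝 0))
    (hw : ∀ y, Tendsto (fun i => ⟪x i, y⟫) l (𝓝 ⟪w, y⟫)) : w ∈ C := by
  obtain ⟨q, hq, hmin⟩ := exists_norm_eq_iInf_of_complete_convex hne hcl.isComplete hcv w
  have hproj := (norm_eq_iInf_iff_real_inner_le_zero hcv hq).1 hmin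
  have hlim : Tendsto (fun i => ⟪w - q, p i - q⟫) l (𝓝 ⟪w - q, w - q⟫) := by
    have h := ((hw (w - q)).sub (hxp.inner (tendsto_const_nhds (x := w - q)))).sub_const ⟪q, w - q⟫
    rw [inner_zero_left, sub_zero, ← inner_sub_left] at h
    refine h.congr fun i => ?_
    rw [← inner_sub_left, ← inner_sub_left, real_inner_comm]
    congr 1
    abel
  have hle : ⟪w - q, w - q⟫ ≤ 0 := le_of_tendsto' hlim fun i => hproj _ (hp i)
  rw [real_inner_self_nonpos, sub_eq_zero] at hle
  exact hle ▸ hq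

/-- If `p` satisfies `⟪x - p, y - p⟫ ≤ 0`, then `p` is no farther from `x` than `y` is. -/
lemma norm_sub_le_of_inner_sub_nonpos {X : Type*} [NormedAddCommGroup X] [InnerProductSpace ℝ X]
    {x p y : X} (h : ⟪x - p, y - p⟫ ≤ 0) : ‖x - p‖ ≤ ‖x - y‖ := by
  have e : x - y = (x - p) - (y - p) := by abel
  have h2 := norm_sub_sq_real (x - p) (y - p)
  rw [← e] at h2
  exact le_of_sq_le_sq (by nlinarith [sq_nonneg ‖y - p‖]) (norm_nonneg _)

/-- The expansion of `‖x - c‖ ^ 2` around an intermediate point `y`. -/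
lemma norm_sub_sq_eq_of_intermediate {X : Type*} [NormedAddCommGroup X] [InnerProductSpace ℝ X]
    (x y c : X) : ‖x - c‖ ^ 2 = ‖x - y‖ ^ 2 - 2 * ⟪x - y, c - y⟫ + ‖y - c‖ ^ 2 := by
  have e : x - c = (x - y) - (c - y) := by abel
  rw [e, norm_sub_sq_real, norm_sub_rev c y]

/-- If `⟪d, c + v - y⟫ ≤ 0` for all `v` with `‖v‖ ≤ r`, then `r * ‖d‖ ≤ -⟪d, c - y⟫`. -/
lemma mul_norm_le_neg_inner {X : Type*} [NormedAddCommGroup X] [InnerProductSpace ℝ X]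
    {c y d : X} {r : ℝ} (hr : 0 ≤ r) (h : ∀ v, ‖v‖ ≤ r → ⟪d, c + v - y⟫ ≤ 0) :
    r * ‖d‖ ≤ -⟪d, c - y⟫ := by
  rcases eq_or_ne d 0 with rfl | hd
  · simp
  have hd' : ‖d‖ ≠ 0 := norm_ne_zero_iff.2 hd
  have h1 := h ((r / ‖d‖) • d) (by
    rw [norm_smul, Real.norm_of_nonneg (by positivity), div_mul_cancel₀ _ hd'])
  rw [add_sub_right_comm, inner_add_right, real_inner_smul_right,
    real_inner_self_eq_norm_sq] at h1
  have e : r / ‖d‖ * ‖d‖ ^ 2 = r * ‖d‖ := by field_simp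
  linarith

/-- A sequence with `⟪x n - x (n + 1), c - x (n + 1)⟫ ≤ 0` for all `c` in a set with nonempty
interior is Cauchy. -/
lemma cauchySeq_of_inner_sub_nonpos {X : Type*} [NormedAddCommGroup X] [InnerProductSpace ℝ X]
    {C : Set X} (hC : (interior C).Nonempty) {x : ℕ → X}
    (hx : ∀ n, ∀ c ∈ C, ⟪x n - x (n + 1), c - x (n + 1)⟫ ≤ 0) : CauchySeq x := by
  obtain ⟨c, hc⟩ := hC
  obtain ⟨r, hr, hball⟩ := Metric.nhds_basis_closedBall.mem_iff.1 (mem_interior_iff_mem_nhds.1 hc)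
  have hstep : ∀ n, 2 * r * ‖x n - x (n + 1)‖ ≤ ‖x n - c‖ ^ 2 - ‖x (n + 1) - c‖ ^ 2 := by
    intro n
    have h1 := mul_norm_le_neg_inner (c := c) (y := x (n + 1)) (d := x n - x (n + 1)) hr.le
      fun v hv => hx n _ (hball (by simpa [Metric.mem_closedBall, dist_eq_norm] using hv))
    have h2 := norm_sub_sq_eq_of_intermediate (x n) (x (n + 1)) c
    nlinarith [sq_nonneg ‖x n - x (n + 1)‖]
  refine cauchySeq_of_summable_dist
    (summable_of_sum_range_le (c := ‖x 0 - c‖ ^ 2 / (2 * r)) (fun n => dist_nonneg) fun n => ?_)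
  rw [le_div_iff₀' (by positivity), Finset.mul_sum]
  calc ∑ i ∈ Finset.range n, 2 * r * dist (x i) (x (i + 1))
      ≤ ∑ i ∈ Finset.range n, (‖x i - c‖ ^ 2 - ‖x (i + 1) - c‖ ^ 2) :=
        Finset.sum_le_sum fun i _ => by rw [dist_eq_norm]; exact hstep i
    _ = ‖x 0 - c‖ ^ 2 - ‖x n - c‖ ^ 2 := Finset.sum_range_sub' (fun i => ‖x i - c‖ ^ 2) n
    _ ≤ ‖x 0 - c‖ ^ 2 := sub_le_self _ (sq_nonneg _)

/-- Convergence of the modified alternating projection algorithm with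
simultaneous projections (Algorithm 4.1 with (4.2b)) in a real Hilbert space: the
iterates converge weakly to a point of `K = K₁ ∩ K₂`, and strongly if `int K ≠ ∅`. -/
theorem convergence_modified_MAP
    {X : Type*} [NormedAddCommGroup X] [InnerProductSpace ℝ X] [CompleteSpace X]
    (K₁ K₂ : Set X)
    (hK₁ne : K₁.Nonempty) (hK₁cl : IsClosed K₁) (hK₁cv : Convex ℝ K₁)
    (hK₂ne : K₂.Nonempty) (hK₂cl : IsClosed K₂) (hK₂cv : Convex ℝ K₂)
    (hK : (K₁ ∩ K₂).Nonempty)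
    (x0 : X) (x : ℕ → X) (xp1 xp2 : ℕ → X)
    (hx0 : x 0 = x0)
    -- `xp1 i = P_{K₁}(x (i-1))` and `xp2 i = P_{K₂}(x (i-1))`
    (hproj1 : ∀ i, 1 ≤ i → xp1 i ∈ K₁ ∧
      ∀ z ∈ K₁, ⟪x (i - 1) - xp1 i, z - xp1 i⟫ ≤ 0)
    (hproj2 : ∀ i, 1 ≤ i → xp2 i ∈ K₂ ∧
      ∀ z ∈ K₂, ⟪x (i - 1) - xp2 i, z - xp2 i⟫ ≤ 0)
    -- `x i = P_{F i}(x (i-1))` where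
    -- `F i = {y | ⟪a i j, y⟫ ≤ b i j, j = 1, 2}`
    (hxF : ∀ i, 1 ≤ i →
      (⟪x (i - 1) - xp1 i, x i⟫ ≤ ⟪x (i - 1) - xp1 i, xp1 i⟫ ∧
       ⟪x (i - 1) - xp2 i, x i⟫ ≤ ⟪x (i - 1) - xp2 i, xp2 i⟫) ∧
      ∀ z : X,
        (⟪x (i - 1) - xp1 i, z⟫ ≤ ⟪x (i - 1) - xp1 i, xp1 i⟫ ∧
         ⟪x (i - 1) - xp2 i, z⟫ ≤ ⟪x (i - 1) - xp2 i, xp2 i⟫) →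
        ⟪x (i - 1) - x i, z - x i⟫ ≤ 0) :
    ∃ z ∈ K₁ ∩ K₂,
      (∀ y : X, Tendsto (fun i => ⟪x i, y⟫) atTop (𝓝 ⟪z, y⟫)) ∧
      ((interior (K₁ ∩ K₂)).Nonempty → Tendsto x atTop (𝓝 z)) := by
  have hfejer : ∀ n, ∀ c ∈ K₁ ∩ K₂, ⟪x n - x (n + 1), c - x (n + 1)⟫ ≤ 0 := fun n c hc =>
    (hxF (n + 1) n.succ_pos).2 c
      ⟨sub_nonpos.1 (by
          simpa only [inner_sub_right] using (hproj1 (n + 1) n.succ_pos).2 c hc.1),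
        sub_nonpos.1 (by
          simpa only [inner_sub_right] using (hproj2 (n + 1) n.succ_pos).2 c hc.2)⟩
  have hdecr : ∀ c ∈ K₁ ∩ K₂, ∀ n,
      ‖x n - x (n + 1)‖ ^ 2 ≤ ‖x n - c‖ ^ 2 - ‖x (n + 1) - c‖ ^ 2 := fun c hc n => by
    linarith [norm_sub_sq_eq_of_intermediate (x n) (x (n + 1)) c, hfejer n c hc]
  have hanti : ∀ c ∈ K₁ ∩ K₂, Antitone fun n => ‖x n - c‖ ^ 2 := fun c hc =>
    antitone_nat_of_succ_le fun n => by linarith [hdecr c hc n, sq_nonneg ‖x n - x (n + 1)‖]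
  have hdist : ∀ c ∈ K₁ ∩ K₂, ∃ l : ℝ, Tendsto (fun i => ‖x i - c‖ ^ 2) atTop (𝓝 l) :=
    fun c hc => ⟨_, tendsto_atTop_ciInf (hanti c hc) ⟨0, by rintro _ ⟨n, rfl⟩; positivity⟩⟩
  obtain ⟨c, hc⟩ := hK
  have hbound : ∀ i, ‖x i‖ ≤ ‖x 0 - c‖ + ‖c‖ := fun i => by
    have h1 : ‖x i - c‖ ≤ ‖x 0 - c‖ :=
      le_of_sq_le_sq (hanti c hc i.zero_le) (norm_nonneg _)
    linarith [norm_le_norm_sub_add (x i) c]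
  have hstep : Tendsto (fun n => ‖x n - x (n + 1)‖) atTop (𝓝 0) := by
    obtain ⟨l, hl⟩ := hdist c hc
    have h := hl.sub (hl.comp (tendsto_add_atTop_nat 1))
    rw [sub_self] at h
    have h2 := (squeeze_zero (fun n => sq_nonneg _) (hdecr c hc) h).sqrt
    simpa using h2
  have hres1 : Tendsto (fun n => x n - xp1 (n + 1)) atTop (𝓝 0) :=
    squeeze_zero_norm (fun n => norm_sub_le_of_inner_sub_nonpos (by
      rw [inner_sub_right]
      exact sub_nonpos.2 (hxF (n + 1) n.succ_pos).1.1)) hstep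
  have hres2 : Tendsto (fun n => x n - xp2 (n + 1)) atTop (𝓝 0) :=
    squeeze_zero_norm (fun n => norm_sub_le_of_inner_sub_nonpos (by
      rw [inner_sub_right]
      exact sub_nonpos.2 (hxF (n + 1) n.succ_pos).1.2)) hstep
  obtain ⟨z, hz, hweak⟩ := exists_weak_limit_of_tendsto_norm_sub (K₁ ∩ K₂) x _ hbound hdist
    fun U w hU hw =>
      ⟨mem_of_weak_limit_of_tendsto_sub hK₁cl hK₁cv hK₁ne
          (fun n => (hproj1 (n + 1) n.succ_pos).1) (hres1.mono_left hU) hw,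
        mem_of_weak_limit_of_tendsto_sub hK₂cl hK₂cv hK₂ne
          (fun n => (hproj2 (n + 1) n.succ_pos).1) (hres2.mono_left hU) hw⟩
  refine ⟨z, hz, hweak, fun hint => ?_⟩
  obtain ⟨w, hw⟩ := cauchySeq_tendsto_of_complete (cauchySeq_of_inner_sub_nonpos hint hfejer)
  have hwz : w = z := ext_inner_right ℝ fun y =>
    tendsto_nhds_unique (hw.inner tendsto_const_nhds) (hweak y)
  exact hwz ▸ hw
end

section
/- Let X be a real Hilbert space and K_1, …, K_r ⊆ X nonempty closed convex sets with ⋂_{l=1}^r K_l = ∅, and let x_0 ∈ X. Suppose the sequences (x_i), (x_i^{(j)}) satisfy, for all i ≥ 1 and j ∈ {1,…,r}: x_i^{(j)} = P_{K_j}(x_{i−1}), and x_i belongs to F_i := {x : ⟪x_{l−1} − x_l^{(j)}, x⟫ ≤ ⟪x_{l−1} − x_l^{(j)}, x_l^{(j)}⟫ for all 1 ≤ l ≤ i, 1 ≤ j ≤ r} (in particular the sets F_i are nonempty and x_i ∈ F_i for all i). Then the sequence (x_i) has no strong cluster point: there is no point x̃ ∈ X and no strictly increasing sequence of indices (i_k)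 with ‖x_{i_k} − x̃‖ → 0. -/
open scoped RealInnerProductSpace
open Filter Topology

/-- If the half-space through `p` with normal `a - p` contains `b`, then `p` is no farther
from `a` than `b` is. -/
lemma norm_sub_le_of_inner_le_inner {X : Type*} [NormedAddCommGroup X] [InnerProductSpace ℝ X]
    {a b p : X} (h : ⟪a - p, b⟫ ≤ ⟪a - p, p⟫) : ‖a - p‖ ≤ ‖a - b‖ := by
  have hsq : ‖a - p‖ * ‖a - p‖ ≤ ‖a - p‖ * ‖a - b‖ :=
    calc ‖a - p‖ * ‖a - p‖ = ⟪a - p, a⟫ - ⟪a - p, p⟫ := by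
          rw [← inner_sub_right, real_inner_self_eq_norm_mul_norm]
      _ ≤ ⟪a - p, a - b⟫ := by rw [inner_sub_right]; linarith
      _ ≤ ‖a - p‖ * ‖a - b‖ := real_inner_le_norm _ _
  by_cases h0 : ‖a - p‖ = 0
  · rw [h0]; exact norm_nonneg _
  · exact le_of_mul_le_mul_left hsq (lt_of_le_of_ne (norm_nonneg _) (Ne.symm h0))

/-- (Theorem 6.1, No cluster point.) If `⋂ l K l = ∅`, the sequence
produced by the best-approximation algorithm with full projections has no strong
cluster point. -/
theorem no_strong_cluster_point_infeasible
    {X : Type*} [NormedAddCommGroup X] [InnerProductSpace ℝ X] [CompleteSpace X]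
    {r : ℕ} (hr : 1 ≤ r)
    (K : Fin r → Set X)
    (hKne : ∀ j, (K j).Nonempty) (hKcl : ∀ j, IsClosed (K j))
    (hKcv : ∀ j, Convex ℝ (K j))
    (hK : ⋂ j, K j = ∅)
    (x0 : X) (x : ℕ → X) (xp : ℕ → Fin r → X)
    (hx0 : x 0 = x0)
    -- `xp i j = P_{K j}(x (i-1))`
    (hproj : ∀ i, 1 ≤ i → ∀ j, xp i j ∈ K j ∧
      ∀ z ∈ K j, ⟪x (i - 1) - xp i j, z - xp i j⟫ ≤ 0)
    -- `x i ∈ F i`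
    (hxF : ∀ i, 1 ≤ i → ∀ l, 1 ≤ l → l ≤ i → ∀ j,
      ⟪x (l - 1) - xp l j, x i⟫ ≤ ⟪x (l - 1) - xp l j, xp l j⟫) :
    ¬ ∃ (xt : X) (ik : ℕ → ℕ), StrictMono ik ∧
        Tendsto (fun k => x (ik k)) atTop (𝓝 xt) := by
  rintro ⟨xt, ik, hik, hlim⟩
  refine Set.eq_empty_iff_forall_notMem.mp hK xt (Set.mem_iInter.mpr fun j => ?_)
  have hle (k : ℕ) : ‖x (ik k) - xp (ik k + 1) j‖ ≤ ‖x (ik k) - x (ik (k + 1))‖ :=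
    norm_sub_le_of_inner_le_inner <| by
      have hlt : ik k < ik (k + 1) := hik k.lt_succ_self
      simpa using hxF (ik (k + 1)) (by omega) (ik k + 1) (by omega) (by omega) j
  have hgap : Tendsto (fun k => ‖x (ik k) - x (ik (k + 1))‖) atTop (𝓝 0) := by
    simpa using (hlim.sub (hlim.comp (tendsto_add_atTop_nat 1))).norm
  have hproj_lim : Tendsto (fun k => xp (ik k + 1) j) atTop (𝓝 xt) := by
    simpa using hlim.sub (squeeze_zero_norm hle hgap)
  exact (hKcl j).mem_of_tendsto hproj_lim
    (Eventually.of_forall fun k => (hproj (ik k + 1) (by omega) j).1)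
end

section
/- Let C ⊆ ℝⁿ be a convex set and x̄ ∈ C. Then for every ε > 0 there exists δ > 0 such that for every point x ∈ (C ∩ B̄_δ(x̄)) with x ≠ x̄ and every unit vector v ∈ N_C(x), one has 0 ≤ ⟪v, x − x̄⟫ ≤ ε · ‖x − x̄‖. -/
open scoped RealInnerProductSpace
open Filter Topology

/-- (Theorem 2.1, Supporting hyperplane near a point.) For a convex
set `C ⊆ ℝⁿ` and `x̄ ∈ C`: for every `ε > 0` there is `δ > 0` such that every unit
normal `v ∈ N_C(x)` at a point `x ∈ C ∩ B̄_δ(x̄)`, `x ≠ x̄`, satisfies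
`0 ≤ ⟪v, x − x̄⟫ ≤ ε ‖x − x̄‖`. -/
theorem supporting_hyperplane_near_point
    {n : ℕ} (C : Set (EuclideanSpace ℝ (Fin n))) (hC : Convex ℝ C)
    (xbar : EuclideanSpace ℝ (Fin n)) (hxbar : xbar ∈ C) :
    ∀ ε : ℝ, 0 < ε → ∃ δ : ℝ, 0 < δ ∧
      ∀ x ∈ C ∩ Metric.closedBall xbar δ, x ≠ xbar →
        ∀ v : EuclideanSpace ℝ (Fin n), ‖v‖ = 1 → v ∈ normalCone C x →
          0 ≤ ⟪v, x - xbar⟫ ∧ ⟪v, x - xbar⟫ ≤ ε * ‖x - xbar‖ := by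
  intro ε hε
  set D : Set (EuclideanSpace ℝ (Fin n)) := {u | ‖u‖ = 1 ∧ ∃ r : ℝ, 0 < r ∧ xbar + r • u ∈ C}
  have hDb : TotallyBounded D :=
    (isCompact_sphere (0 : EuclideanSpace ℝ (Fin n)) 1).totallyBounded.subset
      fun u hu => by simpa using hu.1
  obtain ⟨t, htD, htfin, hcover⟩ :=
    Metric.finite_approx_of_totallyBounded hDb (ε / 2) (half_pos hε)
  have hev : ∀ᶠ δ : ℝ in 𝓝[>] 0, ∀ u ∈ t, ∃ r : ℝ, 2 * δ ≤ r ∧ xbar + r • u ∈ C := by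
    rw [eventually_all_finite htfin]
    intro u hu
    obtain ⟨-, r, hr, hrC⟩ := htD hu
    have hlt : ∀ᶠ δ : ℝ in 𝓝[>] 0, δ < r / 2 :=
      nhdsWithin_le_nhds (Iio_mem_nhds (half_pos hr))
    filter_upwards [hlt] with δ hδ
    exact ⟨r, by linarith, hrC⟩
  obtain ⟨δ, hδt, hδ⟩ := (hev.and self_mem_nhdsWithin).exists
  refine ⟨δ, hδ, ?_⟩
  rintro x ⟨hxC, hxδ⟩ hne v hv hvN
  have hτ : 0 < ‖x - xbar‖ := norm_pos_iff.2 (sub_ne_zero.2 hne)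
  have hτδ : ‖x - xbar‖ ≤ δ := by simpa [dist_eq_norm] using hxδ
  set τ : ℝ := ‖x - xbar‖ with hτdef
  set u := τ⁻¹ • (x - xbar) with hu
  have hxu : x - xbar = τ • u := by rw [hu, smul_inv_smul₀ hτ.ne']
  have huD : u ∈ D := by
    refine ⟨?_, τ, hτ, ?_⟩
    · rw [hu, norm_smul, norm_inv, Real.norm_of_nonneg hτ.le, ← hτdef, inv_mul_cancel₀ hτ.ne']
    · rw [← hxu]; simpa using hxC
  obtain ⟨w, hwt, hw⟩ := Set.mem_iUnion₂.1 (hcover huD)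
  obtain ⟨r, hr, hrC⟩ := hδt w hwt
  have hr0 : 0 < r := by linarith
  -- the ray towards `w` stays in `C` up to distance `2 * τ`
  have hyC : xbar + (2 * τ) • w ∈ C := by
    have h := hC.add_smul_mem hxbar hrC (t := 2 * τ / r)
      ⟨by positivity, (div_le_one hr0).2 (by linarith)⟩
    rwa [smul_smul, div_mul_cancel₀ _ hr0.ne'] at h
  have h1 : ⟪v, xbar - x⟫ ≤ 0 := hvN _ hxbar
  have h2 : ⟪v, xbar + (2 * τ) • w - x⟫ ≤ 0 := hvN _ hyC
  have h3 : ⟪v, u - w⟫ ≤ ε / 2 := by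
    have h := real_inner_le_norm v (u - w)
    rw [hv, one_mul, ← dist_eq_norm] at h
    exact h.trans (Metric.mem_ball.1 hw).le
  have e1 : xbar - x = -(τ • u) := by rw [← hxu, neg_sub]
  have e2 : xbar + (2 * τ) • w - x = (2 * τ) • w - τ • u := by rw [← hxu]; abel
  rw [e1, inner_neg_right] at h1
  rw [e2, inner_sub_right, inner_smul_right, inner_smul_right] at h2
  rw [inner_sub_right] at h3
  rw [hxu]
  refine ⟨by linarith, ?_⟩
  rw [inner_smul_right]
  nlinarith [mul_le_mul_of_nonneg_left h3 hτ.le]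
end

section
/- Let K_1, …, K_r ⊆ ℝⁿ be nonempty closed convex sets with K := ⋂_{l=1}^r K_l ≠ ∅, let p̄ ∈ ℕ, and let (x_i) be generated by the mass projection algorithm with memory p̄: for i ≥ 1 and j ∈ {1,…,r}, x_i^{(j)} = P_{K_j}(x_{i−1}), a_i^{(j)} = x_{i−1} − x_i^{(j)}, b_i^{(j)} = ⟪a_i^{(j)}, x_i^{(j)}⟫, F̃_i = {x : ⟪a_l^{(j)}, x⟫ ≤ b_l^{(j)} for 1 ≤ j ≤ r and max(1, i−p̄) ≤ l ≤ i}, x_i = P_{F̃_i}(x_{i−1}). Suppose (x_i) converges to x̄ ∈ K, is Fejér monotone with respect to K, x_i ≠ x̄ for all i, and: whenever v_l ∈ N_{K_l}(x̄) for l = 1,…,r and Σ_{l=1}^r v_l = 0, then v_l = 0 for all l. Then lim_{i→∞} ‖P_{N_K(x̄)}(x_i − x̄)‖ / ‖x_i − x̄‖ = 1. -/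
open scoped RealInnerProductSpace
open Filter Topology

/-- A sequence that is Fejér monotone with respect to `{z}` and converges to `p` satisfies a
second-order bound on `⟪x i - p, z - p⟫`. -/
lemma inner_sub_le_of_fejer {E : Type*} [NormedAddCommGroup E] [InnerProductSpace ℝ E]
    {x : ℕ → E} {p z : E} (hx : Tendsto x atTop (𝓝 p))
    (hz : ∀ i, ‖x (i + 1) - z‖ ≤ ‖x i - z‖) (i : ℕ) :
    ⟪x i - p, z - p⟫ ≤ ‖x i - p‖ ^ 2 / 2 := by
  have hle : ‖p - z‖ ≤ ‖x i - z‖ :=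
    (antitone_nat_of_succ_le (f := fun i => ‖x i - z‖) hz).le_of_tendsto
      (hx.sub_const z).norm i
  have hsq : ‖x i - z‖ ^ 2 = ‖x i - p‖ ^ 2 - 2 * ⟪x i - p, z - p⟫ + ‖z - p‖ ^ 2 := by
    rw [← norm_sub_sq_real, sub_sub_sub_cancel_right]
  rw [norm_sub_rev p z] at hle
  nlinarith [pow_le_pow_left₀ (norm_nonneg _) hle 2]

/-- The variational inequality `⟪y - q, z - q⟫ ≤ 0` makes `q` at least as close to `y` as `z`. -/
lemma norm_sub_le_of_inner_nonpos_s9 {E : Type*} [NormedAddCommGroup E] [InnerProductSpace ℝ E]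
    {y q z : E} (h : ⟪y - q, z - q⟫ ≤ 0) : ‖y - q‖ ≤ ‖y - z‖ := by
  have hsq : ‖y - z‖ ^ 2 = ‖y - q‖ ^ 2 - 2 * ⟪y - q, z - q⟫ + ‖z - q‖ ^ 2 := by
    rw [← norm_sub_sq_real, sub_sub_sub_cancel_right]
  exact le_of_sq_le_sq (by nlinarith [sq_nonneg ‖z - q‖]) (norm_nonneg _)

lemma smul_mem_normalCone {E : Type*} [NormedAddCommGroup E] [InnerProductSpace ℝ E]
    {C : Set E} {p v : E} (hv : v ∈ normalCone C p) {t : ℝ} (ht : 0 ≤ t) :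
    t • v ∈ normalCone C p := fun y hy => by
  rw [real_inner_smul_left]
  exact mul_nonpos_of_nonneg_of_nonpos ht (hv y hy)

/-- (Lemma 5.4, Approach of iterates to `x̄`.) For the mass
projection algorithm with memory `p̄`, if the iterates converge to `x̄ ∈ K`, are
Fejér monotone with respect to `K`, never equal `x̄`, and the normal cone alignment
condition holds, then `‖P_{N_K(x̄)}(x_i − x̄)‖ / ‖x_i − x̄‖ → 1`. -/
theorem approach_of_iterates_within_normal_cone
    {n : ℕ} {r : ℕ} (hr : 1 ≤ r)
    (K : Fin r → Set (EuclideanSpace ℝ (Fin n)))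
    (hKne : ∀ j, (K j).Nonempty) (hKcl : ∀ j, IsClosed (K j))
    (hKcv : ∀ j, Convex ℝ (K j))
    (xbar : EuclideanSpace ℝ (Fin n)) (hxbar : xbar ∈ ⋂ j, K j)
    (pbar : ℕ)
    (x : ℕ → EuclideanSpace ℝ (Fin n))
    (xp : ℕ → Fin r → EuclideanSpace ℝ (Fin n))
    -- `xp i j = P_{K j}(x (i-1))`
    (hproj : ∀ i, 1 ≤ i → ∀ j, xp i j ∈ K j ∧
      ∀ z ∈ K j, ⟪x (i - 1) - xp i j, z - xp i j⟫ ≤ 0)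
    -- `x i = P_{F̃ i}(x (i-1))`
    (hxF : ∀ i, 1 ≤ i →
      (∀ l, max 1 (i - pbar) ≤ l → l ≤ i → ∀ j,
        ⟪x (l - 1) - xp l j, x i⟫ ≤ ⟪x (l - 1) - xp l j, xp l j⟫) ∧
      ∀ z : EuclideanSpace ℝ (Fin n),
        (∀ l, max 1 (i - pbar) ≤ l → l ≤ i → ∀ j,
          ⟪x (l - 1) - xp l j, z⟫ ≤ ⟪x (l - 1) - xp l j, xp l j⟫) →
        ⟪x (i - 1) - x i, z - x i⟫ ≤ 0)
    -- convergence to `x̄` and Fejér monotonicity with respect to `K`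
    (hconv : Tendsto x atTop (𝓝 xbar))
    (hFejer : ∀ c ∈ ⋂ j, K j, ∀ i : ℕ, ‖x (i + 1) - c‖ ≤ ‖x i - c‖)
    (hne : ∀ i, x i ≠ xbar)
    -- alignment condition on the normal cones at `x̄`
    (hcond : ∀ v : Fin r → EuclideanSpace ℝ (Fin n),
      (∀ l, v l ∈ normalCone (K l) xbar) → ∑ l, v l = 0 → ∀ l, v l = 0)
    -- `q i = P_{N_K(x̄)}(x i − x̄)`
    (q : ℕ → EuclideanSpace ℝ (Fin n))
    (hq : ∀ i, q i ∈ normalCone (⋂ j, K j) xbar ∧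
      ∀ z ∈ normalCone (⋂ j, K j) xbar, ⟪(x i - xbar) - q i, z - q i⟫ ≤ 0) :
    Tendsto (fun i => ‖q i‖ / ‖x i - xbar‖) atTop (𝓝 1) := by
  have hpos : ∀ i, 0 < ‖x i - xbar‖ := fun i => norm_pos_iff.2 (sub_ne_zero.2 (hne i))
  have hdist : Tendsto (fun i => ‖x i - xbar‖) atTop (𝓝 0) :=
    tendsto_iff_norm_sub_tendsto_zero.1 hconv
  refine tendsto_of_subseq_tendsto fun ns hns => ?_
  let u : ℕ → EuclideanSpace ℝ (Fin n) := fun i => ‖x i - xbar‖⁻¹ • (x i - xbar)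
  have hu : ∀ i, ‖x i - xbar‖ • u i = x i - xbar := fun i =>
    smul_inv_smul₀ (hpos i).ne' _
  have hmem : ∀ i, u i ∈ Metric.sphere (0 : EuclideanSpace ℝ (Fin n)) 1 := fun i => by
    rw [mem_sphere_zero_iff_norm, norm_smul, norm_inv, norm_norm, inv_mul_cancel₀ (hpos i).ne']
  obtain ⟨w, -, ms, hms, hw⟩ := (isCompact_sphere _ _).tendsto_subseq fun k => hmem (ns k)
  have hsub : Tendsto (fun k => ns (ms k)) atTop atTop := hns.comp hms.tendsto_atTop
  have hwN : w ∈ normalCone (⋂ j, K j) xbar := fun z hz => by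
    have hbound : Tendsto (fun k => ‖x (ns (ms k)) - xbar‖ / 2) atTop (𝓝 0) := by
      simpa using (hdist.comp hsub).div_const 2
    refine le_of_tendsto_of_tendsto' (hw.inner tendsto_const_nhds) hbound fun k => ?_
    have h := inner_sub_le_of_fejer hconv (hFejer z hz) (ns (ms k))
    rw [← hu, real_inner_smul_left, hu] at h
    exact le_of_mul_le_mul_left (h.trans_eq (by ring)) (hpos _)
  refine ⟨ms, tendsto_iff_norm_sub_tendsto_zero.2 ?_⟩
  refine squeeze_zero (fun _ => norm_nonneg _) (fun k => ?_)
    (tendsto_iff_norm_sub_tendsto_zero.1 hw)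
  set i := ns (ms k)
  have hnear : ‖x i - xbar - q i‖ ≤ ‖x i - xbar‖ * ‖u i - w‖ := by
    have h := norm_sub_le_of_inner_nonpos_s9
      ((hq i).2 _ (smul_mem_normalCone hwN (norm_nonneg (x i - xbar))))
    rwa [← norm_norm (x i - xbar), ← norm_smul, smul_sub, hu]
  rw [div_sub_one (hpos i).ne', norm_div, norm_norm, div_le_iff₀' (hpos i), Real.norm_eq_abs]
  refine (abs_norm_sub_norm_le _ _).trans ?_
  rwa [norm_sub_rev]
end

section
/- Let K_1, …, K_r ⊆ ℝⁿ be nonempty closed convex sets, K := ⋂_{l=1}^r K_l, and let (x_i) be a sequence converging to a point x̄ ∈ K with x_i ≠ x̄ for all i. Assume that K_1, …, K_r satisfy the local metric inequality at x̄, and that lim_{i→∞} ‖P_{N_K(x̄)}(x_i − x̄)‖ / ‖x_i − x̄‖ = 1. Then there exists β > 0 such that ‖x_i − x̄‖ ≤ β · max_{1 ≤ l ≤ r} d(x_i, K_l) for all sufficiently large i. -/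
open scoped RealInnerProductSpace
open Filter Topology

/-- The distance from `x` to `C` is at least the norm of the projection of `x - a` onto the
normal cone of `C` at `a`. -/
lemma norm_le_infDist_of_mem_normalCone {E : Type*} [NormedAddCommGroup E]
    [InnerProductSpace ℝ E] {C : Set E} (hC : C.Nonempty) {a x q : E}
    (hq : q ∈ normalCone C a) (hproj : ∀ z ∈ normalCone C a, ⟪(x - a) - q, z - q⟫ ≤ 0) :
    ‖q‖ ≤ Metric.infDist x C := by
  rw [Metric.le_infDist hC]
  intro y hy
  have h0 := hproj 0 fun y _ => by simp
  have h1 := hq y hy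
  have h2 := real_inner_le_norm q (x - y)
  rw [zero_sub, inner_neg_right, inner_sub_left, real_inner_self_eq_norm_sq,
    real_inner_comm] at h0
  have h3 : ⟪q, x - y⟫ = ⟪q, x - a⟫ - ⟪q, y - a⟫ := by
    rw [← inner_sub_right, sub_sub_sub_cancel_right]
  rw [dist_eq_norm]
  rcases (norm_nonneg q).eq_or_lt with hz | hpos
  · rw [← hz]
    exact norm_nonneg _
  · refine le_of_mul_le_mul_left ?_ hpos
    nlinarith

/-- (Lemma 5.9, Estimates under local metric inequality.) If a
sequence converges to `x̄ ∈ K = ⋂ l K l`, the sets satisfy the local metric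
inequality at `x̄`, and `‖P_{N_K(x̄)}(x_i − x̄)‖ / ‖x_i − x̄‖ → 1`, then for some
`β > 0`, `‖x_i − x̄‖ ≤ β · max_l d(x_i, K_l)` for all large `i`. -/
theorem estimate_under_local_metric_inequality
    {n : ℕ} {r : ℕ} (hr : 1 ≤ r)
    (K : Fin r → Set (EuclideanSpace ℝ (Fin n)))
    (hKne : ∀ l, (K l).Nonempty) (hKcl : ∀ l, IsClosed (K l))
    (hKcv : ∀ l, Convex ℝ (K l))
    (xbar : EuclideanSpace ℝ (Fin n)) (hxbar : xbar ∈ ⋂ l, K l)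
    (x : ℕ → EuclideanSpace ℝ (Fin n))
    (hconv : Tendsto x atTop (𝓝 xbar))
    (hne : ∀ i, x i ≠ xbar)
    -- local metric inequality at `x̄`
    (hlmi : ∃ β' : ℝ, 0 < β' ∧ ∃ δ : ℝ, 0 < δ ∧
      ∀ y ∈ Metric.closedBall xbar δ,
        Metric.infDist y (⋂ l, K l) ≤ β' * ⨆ l, Metric.infDist y (K l))
    -- `q i = P_{N_K(x̄)}(x i − x̄)` and the limit of the ratios is `1`
    (q : ℕ → EuclideanSpace ℝ (Fin n))
    (hq : ∀ i, q i ∈ normalCone (⋂ l, K l) xbar ∧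
      ∀ z ∈ normalCone (⋂ l, K l) xbar, ⟪(x i - xbar) - q i, z - q i⟫ ≤ 0)
    (hlim : Tendsto (fun i => ‖q i‖ / ‖x i - xbar‖) atTop (𝓝 1)) :
    ∃ β : ℝ, 0 < β ∧ ∃ N : ℕ, ∀ i ≥ N,
      ‖x i - xbar‖ ≤ β * ⨆ l, Metric.infDist (x i) (K l) := by
  obtain ⟨β, hβ, δ, hδ, hreg⟩ := hlmi
  refine ⟨2 * β, by positivity, eventually_atTop.1 ?_⟩
  filter_upwards [hconv (Metric.closedBall_mem_nhds xbar hδ),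
    hlim.eventually_const_lt (by norm_num : (1 / 2 : ℝ) < 1)] with i hi hratio
  have hpos : 0 < ‖x i - xbar‖ := norm_sub_pos_iff.2 (hne i)
  rw [lt_div_iff₀ hpos] at hratio
  have hdist := norm_le_infDist_of_mem_normalCone ⟨xbar, hxbar⟩ (hq i).1 (hq i).2
  linarith [hreg (x i) hi]
end

section
/- Let K_1, …, K_r ⊆ ℝⁿ be nonempty closed convex sets and x̄ ∈ K := ⋂_{l=1}^r K_l. Assume: whenever v_l ∈ N_{K_l}(x̄) for l = 1,…,r and Σ_{l=1}^r v_l = 0, then v_l = 0 for all l. Then K_1, …, K_r satisfy the local metric inequality at x̄: there exist β > 0 and δ > 0 such that d(x, K) ≤ β · max_{1 ≤ l ≤ r} d(x, K_l) for all x in the closed ball B̄_δ(x̄). -/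
open scoped RealInnerProductSpace
open Filter Topology

/-- In a finite-dimensional space, a convex set `s` containing `0` is a neighbourhood of `0` as soon
as the only continuous linear functional that is nonpositive on `s` is zero. -/
theorem Convex.mem_interior_of_forall_functional_eq_zero {V : Type*} [NormedAddCommGroup V]
    [NormedSpace ℝ V] [FiniteDimensional ℝ V] {s : Set V} (hs : Convex ℝ s) (h₀ : (0 : V) ∈ s)
    (h : ∀ f : StrongDual ℝ V, (∀ a ∈ s, f a ≤ 0) → f = 0) : (0 : V) ∈ interior s := by
  by_contra hnot
  rcases (interior s).eq_empty_or_nonempty with hempty | hne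
  · have hspan : Submodule.span ℝ s ≠ ⊤ := by
      intro htop
      have haff : affineSpan ℝ s = ⊤ := by
        have := affineSpan_insert_zero (k := ℝ) s
        rw [Set.insert_eq_of_mem h₀, htop] at this
        exact SetLike.coe_injective (by simpa using this)
      have := hs.interior_nonempty_iff_affineSpan_eq_top.2 haff
      simp [hempty] at this
    obtain ⟨f, hf, hle⟩ := Submodule.exists_le_ker_of_lt_top _ hspan.lt_top
    refine hf ?_
    have h0 := h (LinearMap.toContinuousLinearMap f)
      fun a ha => (hle (Submodule.subset_span ha)).le
    ext a
    simpa using congrArg (fun g : StrongDual ℝ V => g a) h0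
  · obtain ⟨f, hf, hle⟩ := geometric_hahn_banach_of_nonempty_interior_point hs hnot hne
    exact hf (h f fun a ha => by simpa using hle a ha)

/-- For a convex set, normality at `x` can be tested on points within distance `1` of `x`. -/
theorem mem_normalCone_of_local {E : Type*} [NormedAddCommGroup E] [InnerProductSpace ℝ E]
    {C : Set E} (hC : Convex ℝ C) {x v : E} (hx : x ∈ C)
    (hv : ∀ y ∈ C, ‖y - x‖ ≤ 1 → ⟪v, y - x⟫ ≤ 0) : v ∈ normalCone C x := by
  intro y hy
  have hpos : 0 < 1 + ‖y - x‖ := by positivity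
  have hmem : x + (1 + ‖y - x‖)⁻¹ • (y - x) ∈ C :=
    hC.add_smul_sub_mem hx hy ⟨by positivity, inv_le_one_of_one_le₀ (by simp)⟩
  have hloc := hv _ hmem (by
    rw [add_sub_cancel_left, norm_smul, Real.norm_of_nonneg (by positivity),
      inv_mul_le_iff₀ hpos]
    linarith)
  rw [add_sub_cancel_left, real_inner_smul_right] at hloc
  exact nonpos_of_mul_nonpos_right hloc (by positivity)

/-- If the normal cones of the convex sets `K l` at a common point `x` are aligned, there is `η > 0`
such that for all vectors `a l` of norm at most `η`, the translates `K l - a l` have a common point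
`z`, with each `z + a l` within distance `1` of `x`. -/
theorem exists_translation_radius {ι E : Type*} [Fintype ι] [NormedAddCommGroup E]
    [InnerProductSpace ℝ E] [FiniteDimensional ℝ E] {K : ι → Set E}
    (hK : ∀ l, Convex ℝ (K l)) {x : E} (hx : ∀ l, x ∈ K l)
    (hcond : ∀ v : ι → E, (∀ l, v l ∈ normalCone (K l) x) → ∑ l, v l = 0 → ∀ l, v l = 0) :
    ∃ η : ℝ, 0 < η ∧ ∀ a : ι → E, (∀ l, ‖a l‖ ≤ η) →
      ∃ z : E, ∀ l, z + a l ∈ K l ∧ ‖z + a l - x‖ ≤ 1 := by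
  classical
  let A : Set (ι → E) := {a | ∃ z : E, ∀ l, z + a l ∈ K l ∧ ‖z + a l - x‖ ≤ 1}
  have hA : Convex ℝ A := by
    rintro a ⟨z, hz⟩ b ⟨w, hw⟩ s t hs ht hst
    refine ⟨s • z + t • w, fun l => ?_⟩
    have hball (c : E) : ‖c - x‖ ≤ 1 ↔ c ∈ Metric.closedBall x 1 := by
      rw [mem_closedBall_iff_norm]
    have heq : s • z + t • w + (s • a + t • b) l = s • (z + a l) + t • (w + b l) := by
      simp only [Pi.add_apply, Pi.smul_apply, smul_add]
      abel
    rw [heq]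
    refine ⟨hK l (hz l).1 (hw l).1 hs ht hst, (hball _).2 ?_⟩
    exact convex_closedBall x 1 ((hball _).1 (hz l).2) ((hball _).1 (hw l).2) hs ht hst
  have hA₀ : (0 : ι → E) ∈ A := ⟨x, fun l => by simp [hx l]⟩
  have hint : (0 : ι → E) ∈ interior A := by
    refine hA.mem_interior_of_forall_functional_eq_zero hA₀ fun f hf => ?_
    let v : ι → E := fun l =>
      (InnerProductSpace.toDual ℝ E).symm (f.comp (ContinuousLinearMap.single ℝ (fun _ => E) l))
    have hv (l : ι) (y : E) : ⟪v l, y⟫ = f (Pi.single l y) := by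
      simp [v]
    have hfsum (a : ι → E) : f a = ∑ l, ⟪v l, a l⟫ := by
      simp only [hv, ← map_sum, Finset.univ_sum_single]
    have hcone (l : ι) : v l ∈ normalCone (K l) x := by
      refine mem_normalCone_of_local (hK l) (hx l) fun y hy hyx => ?_
      rw [hv]
      refine hf _ ⟨x, fun m => ?_⟩
      rcases eq_or_ne m l with rfl | hm
      · simpa using ⟨hy, hyx⟩
      · simp [hm, hx m]
    have hsum : ∑ l, v l = 0 := by
      have h := hf (fun _ => ∑ l, v l) ⟨x - ∑ l, v l, fun l => by simp [hx l]⟩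
      rw [hfsum, ← sum_inner] at h
      exact inner_self_eq_zero.1 (h.antisymm real_inner_self_nonneg)
    have hzero := hcond v hcone hsum
    ext a
    simp [hfsum, hzero]
  obtain ⟨η, hη, hsub⟩ := Metric.nhds_basis_closedBall.mem_iff.1 (mem_interior_iff_mem_nhds.1 hint)
  refine ⟨η, hη, fun a ha => hsub ?_⟩
  rw [mem_closedBall_zero_iff]
  exact (pi_norm_le_iff_of_nonneg hη.le).2 ha

/-- (Lemma 5.10, Condition for local metric inequality.) If the
normal cones of `K_1, …, K_r` at `x̄ ∈ K = ⋂ l K l` are aligned — the only way to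
write `0` as a sum of normals is trivially — then the collection satisfies the
local metric inequality at `x̄`. -/
theorem local_metric_inequality_of_alignment
    {n : ℕ} {r : ℕ} (hr : 1 ≤ r)
    (K : Fin r → Set (EuclideanSpace ℝ (Fin n)))
    (hKne : ∀ l, (K l).Nonempty) (hKcl : ∀ l, IsClosed (K l))
    (hKcv : ∀ l, Convex ℝ (K l))
    (xbar : EuclideanSpace ℝ (Fin n)) (hxbar : xbar ∈ ⋂ l, K l)
    (hcond : ∀ v : Fin r → EuclideanSpace ℝ (Fin n),
      (∀ l, v l ∈ normalCone (K l) xbar) → ∑ l, v l = 0 → ∀ l, v l = 0) :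
    ∃ β : ℝ, 0 < β ∧ ∃ δ : ℝ, 0 < δ ∧
      ∀ y ∈ Metric.closedBall xbar δ,
        Metric.infDist y (⋂ l, K l) ≤ β * ⨆ l, Metric.infDist y (K l) := by
  have hx : ∀ l, xbar ∈ K l := Set.mem_iInter.1 hxbar
  obtain ⟨η, hη, hshift⟩ := exists_translation_radius hKcv hx hcond
  refine ⟨(2 + η) / η, by positivity, 1, one_pos, fun y hy => ?_⟩
  set d : ℝ := ⨆ l, Metric.infDist y (K l) with hd
  have hle (l : Fin r) : Metric.infDist y (K l) ≤ d :=
    le_ciSup (f := fun l => Metric.infDist y (K l)) (Set.finite_range _).bddAbove l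
  have hd₀ : 0 ≤ d := Real.iSup_nonneg fun _ => Metric.infDist_nonneg
  choose p hpK hp using fun l => (hKcl l).exists_infDist_eq_dist (hKne l) y
  have hpd (l : Fin r) : ‖p l - y‖ ≤ d := by
    rw [← dist_eq_norm, dist_comm, ← hp l]
    exact hle l
  rcases hd₀.eq_or_lt with hd_zero | hd_pos
  · have hyK : y ∈ ⋂ l, K l := Set.mem_iInter.2 fun l => by
      have hpy : p l = y := by simpa [← hd_zero, sub_eq_zero] using hpd l
      exact hpy ▸ hpK l
    simp [Metric.infDist_zero_of_mem hyK, ← hd_zero]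
  · obtain ⟨z, hz⟩ := hshift (fun l => -((η / d) • (p l - y))) fun l => by
      rw [norm_neg, norm_smul, Real.norm_of_nonneg (by positivity)]
      calc η / d * ‖p l - y‖ ≤ η / d * d := by gcongr; exact hpd l
        _ = η := by field_simp
    have hmem : y + (d / (d + η)) • (z - y) ∈ ⋂ l, K l := Set.mem_iInter.2 fun l => by
      have hconv := hKcv l (hpK l) (hz l).1 (a := η / (d + η)) (b := d / (d + η))
        (by positivity) (by positivity) (by field_simp; ring)
      convert hconv using 1
      have hcoef : d / (d + η) * (η / d) = η / (d + η) := by field_simp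
      have hone : η / (d + η) = 1 - d / (d + η) := by field_simp; ring
      rw [smul_add, smul_neg, smul_smul, hcoef, hone]
      module
    let l₀ : Fin r := ⟨0, hr⟩
    have hzx : ‖z - xbar‖ ≤ 1 + η := by
      have hshift_le : ‖(η / d) • (p l₀ - y)‖ ≤ η := by
        rw [norm_smul, Real.norm_of_nonneg (by positivity)]
        calc η / d * ‖p l₀ - y‖ ≤ η / d * d := by gcongr; exact hpd l₀
          _ = η := by field_simp
      calc ‖z - xbar‖ = ‖(z + -((η / d) • (p l₀ - y)) - xbar) + (η / d) • (p l₀ - y)‖ := by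
            congr 1; abel
        _ ≤ 1 + η := (norm_add_le _ _).trans (add_le_add (hz l₀).2 hshift_le)
    have hzy : ‖z - y‖ ≤ 2 + η := by
      rw [mem_closedBall_iff_norm'] at hy
      linarith [norm_sub_le_norm_sub_add_norm_sub z xbar y]
    calc Metric.infDist y (⋂ l, K l) ≤ dist y (y + (d / (d + η)) • (z - y)) :=
          Metric.infDist_le_dist_of_mem hmem
      _ = d / (d + η) * ‖z - y‖ := by
          rw [dist_self_add_right, norm_smul, Real.norm_of_nonneg (by positivity)]
      _ ≤ d / η * (2 + η) := by
          gcongr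
          linarith
      _ = (2 + η) / η * d := by ring
end

section
/- Let K ⊆ ℝⁿ (n ≥ 1) be a closed, pointed convex cone, i.e. K ∩ (−K) ⊆ {0}. Then there exist a unit vector d in the positive polar cone K⁺ and a constant c > 0 such that the closed ball B̄_c(d) is contained in K⁺; consequently, ⟪d, v⟫ ≥ c for every unit vector v ∈ K. -/
open scoped RealInnerProductSpace
open Filter Topology

section PointedCone

variable {E : Type*} [NormedAddCommGroup E] [InnerProductSpace ℝ E]

/-- Farkas' lemma for a closed convex cone given as a set: a point outside is strictly separated
by a vector of the polar cone. -/
theorem exists_mem_polar_inner_neg [CompleteSpace E] {K : Set E} (hcl : IsClosed K)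
    (hcv : Convex ℝ K) (hcone : ∀ v ∈ K, ∀ t : ℝ, 0 ≤ t → t • v ∈ K) (hne : K.Nonempty)
    {x : E} (hx : x ∉ K) : ∃ w : E, (∀ v ∈ K, 0 ≤ ⟪w, v⟫) ∧ ⟪w, x⟫ < 0 := by
  obtain ⟨u, hu⟩ := hne
  let C : ProperCone ℝ E :=
    { carrier := K
      add_mem' := by
        intro a b ha hb
        have h := hcone _ (hcv ha hb (by norm_num : (0 : ℝ) ≤ 1 / 2)
          (by norm_num : (0 : ℝ) ≤ 1 / 2) (by norm_num)) 2 (by norm_num)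
        simpa [smul_add, smul_smul] using h
      zero_mem' := by simpa using hcone u hu 0 le_rfl
      smul_mem' := fun t v hv => hcone v hv t t.2
      isClosed' := hcl }
  obtain ⟨w, hw, hwx⟩ := C.hyperplane_separation' (x₀ := x) hx
  refine ⟨w, fun v hv => ?_, ?_⟩
  · rw [real_inner_comm]
    exact hw v hv
  · rwa [real_inner_comm]

/-- A vector of the polar cone of a closed pointed convex cone that is strictly positive on all
unit vectors of the cone. -/
theorem exists_mem_polar_inner_pos [FiniteDimensional ℝ E] {K : Set E} (hcl : IsClosed K)
    (hcv : Convex ℝ K) (hcone : ∀ v ∈ K, ∀ t : ℝ, 0 ≤ t → t • v ∈ K)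
    (hpointed : ∀ v ∈ K, -v ∈ K → v = 0) :
    ∃ w : E, (∀ v ∈ K, 0 ≤ ⟪w, v⟫) ∧ ∀ v ∈ K ∩ Metric.sphere 0 1, 0 < ⟪w, v⟫ := by
  have : ProperSpace E := FiniteDimensional.proper ℝ E
  have hS : IsCompact (K ∩ Metric.sphere (0 : E) 1) := (isCompact_sphere _ _).inter_left hcl
  suffices H : ∃ w : E, (∀ v ∈ K, 0 ≤ ⟪w, v⟫) ∧
      ∀ v ∈ K ∩ Metric.sphere (0 : E) 1, v ∈ K → 0 < ⟪w, v⟫ by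
    obtain ⟨w, hw, hpos⟩ := H
    exact ⟨w, hw, fun v hv => hpos v hv hv.1⟩
  refine hS.induction_on (p := fun s => ∃ w : E, (∀ v ∈ K, 0 ≤ ⟪w, v⟫) ∧
      ∀ v ∈ s, v ∈ K → 0 < ⟪w, v⟫) ?_ ?_ ?_ ?_
  · exact ⟨0, by simp, by simp⟩
  · rintro s t hst ⟨w, hw, hpos⟩
    exact ⟨w, hw, fun v hv => hpos v (hst hv)⟩
  · rintro s t ⟨w, hw, hws⟩ ⟨z, hz, hzt⟩
    refine ⟨w + z, fun v hv => ?_, fun v hv hvK => ?_⟩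
    · rw [inner_add_left]
      exact add_nonneg (hw v hv) (hz v hv)
    · rw [inner_add_left]
      rcases hv with hv | hv
      · exact add_pos_of_pos_of_nonneg (hws v hv hvK) (hz v hvK)
      · exact add_pos_of_nonneg_of_pos (hw v hvK) (hzt v hv hvK)
  · rintro x ⟨hxK, hx⟩
    have hx0 : x ≠ 0 := ne_zero_of_mem_unit_sphere ⟨x, hx⟩
    obtain ⟨w, hw, hwx⟩ := exists_mem_polar_inner_neg hcl hcv hcone ⟨x, hxK⟩
      (fun h => hx0 (hpointed x hxK h))
    rw [inner_neg_right, neg_lt_zero] at hwx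
    have hopen : IsOpen {v : E | 0 < ⟪w, v⟫} := isOpen_lt (by fun_prop) (by fun_prop)
    exact ⟨_, mem_nhdsWithin_of_mem_nhds (hopen.mem_nhds hwx), w, hw, fun v hv _ => hv⟩

/-- On a closed pointed convex cone, the inner product with a suitable unit vector dominates
a positive multiple of the norm. -/
theorem exists_unit_mul_norm_le_inner [FiniteDimensional ℝ E] [Nontrivial E] {K : Set E}
    (hcl : IsClosed K) (hcv : Convex ℝ K) (hcone : ∀ v ∈ K, ∀ t : ℝ, 0 ≤ t → t • v ∈ K)
    (hpointed : ∀ v ∈ K, -v ∈ K → v = 0) :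
    ∃ (d : E) (c : ℝ), 0 < c ∧ ‖d‖ = 1 ∧ ∀ v ∈ K, c * ‖v‖ ≤ ⟪d, v⟫ := by
  have : ProperSpace E := FiniteDimensional.proper ℝ E
  have hnorm : ∀ v ∈ K, v ≠ 0 → ‖v‖⁻¹ • v ∈ K ∩ Metric.sphere (0 : E) 1 := fun v hv hv0 =>
    ⟨hcone v hv _ (by positivity), by simp [norm_smul, hv0]⟩
  rcases (K ∩ Metric.sphere (0 : E) 1).eq_empty_or_nonempty with hS | hS
  · obtain ⟨d, hd⟩ := exists_norm_eq E (zero_le_one : (0 : ℝ) ≤ 1)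
    refine ⟨d, 1, one_pos, hd, fun v hv => ?_⟩
    by_cases hv0 : v = 0
    · simp [hv0]
    · exact absurd (hnorm v hv hv0) (by simp [hS])
  · obtain ⟨w, -, hpos⟩ := exists_mem_polar_inner_pos hcl hcv hcone hpointed
    obtain ⟨x, hx, hmin⟩ := ((isCompact_sphere (0 : E) 1).inter_left hcl).exists_isMinOn hS
      (f := fun v => ⟪w, v⟫) (by fun_prop)
    have hw0 : w ≠ 0 := by
      rintro rfl
      simpa using hpos x hx
    have hw : 0 < ‖w‖ := norm_pos_iff.2 hw0
    refine ⟨‖w‖⁻¹ • w, ‖w‖⁻¹ * ⟪w, x⟫, mul_pos (inv_pos.2 hw) (hpos x hx),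
      by simp [norm_smul, hw0], fun v hv => ?_⟩
    by_cases hv0 : v = 0
    · simp [hv0]
    · have h : ⟪w, x⟫ ≤ ⟪w, ‖v‖⁻¹ • v⟫ := hmin (hnorm v hv hv0)
      have hvpos : 0 < ‖v‖ := norm_pos_iff.2 hv0
      rw [real_inner_smul_right, inv_mul_eq_div, le_div_iff₀ hvpos] at h
      rw [real_inner_smul_left, mul_assoc]
      gcongr

end PointedCone

/-- (Proposition 5.6, Pointed cone.) A closed pointed convex cone
`K ⊆ ℝⁿ` admits a unit vector `d` in its positive polar cone `K⁺` and a constant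
`c > 0` with `B̄_c(d) ⊆ K⁺`; consequently `⟪d, v⟫ ≥ c` for every unit vector
`v ∈ K`. -/
theorem pointed_cone_polar_interior
    {n : ℕ} (hn : 1 ≤ n)
    (K : Set (EuclideanSpace ℝ (Fin n)))
    (hKcl : IsClosed K) (hKcv : Convex ℝ K)
    (hKcone : ∀ v ∈ K, ∀ t : ℝ, 0 ≤ t → t • v ∈ K)
    (hKpointed : ∀ v ∈ K, -v ∈ K → v = 0) :
    ∃ (d : EuclideanSpace ℝ (Fin n)) (c : ℝ), 0 < c ∧ ‖d‖ = 1 ∧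
      (∀ v ∈ K, 0 ≤ ⟪d, v⟫) ∧
      Metric.closedBall d c ⊆ {w : EuclideanSpace ℝ (Fin n) | ∀ v ∈ K, 0 ≤ ⟪w, v⟫} ∧
      ∀ v ∈ K, ‖v‖ = 1 → c ≤ ⟪d, v⟫ := by
  have : Nonempty (Fin n) := ⟨⟨0, hn⟩⟩
  obtain ⟨d, c, hc, hd, h⟩ := exists_unit_mul_norm_le_inner hKcl hKcv hKcone hKpointed
  refine ⟨d, c, hc, hd, fun v hv => (by positivity : 0 ≤ c * ‖v‖).trans (h v hv),
    fun w hw v hv => ?_, fun v hv hv1 => by simpa [hv1] using h v hv⟩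
  have hsplit : ⟪w, v⟫ = ⟪d, v⟫ + ⟪w - d, v⟫ := by rw [inner_sub_left]; ring
  have hcs : |⟪w - d, v⟫| ≤ c * ‖v‖ :=
    (abs_real_inner_le_norm _ _).trans (by gcongr; exact mem_closedBall_iff_norm.1 hw)
  linarith [h v hv, neg_le_of_abs_le hcs]
end

section
/- Let K ⊆ ℝⁿ be a closed, pointed convex cone (K ∩ (−K) ⊆ {0}), let (v_i)_{i≥1} be unit vectors in ℝⁿ all of whose cluster points belong to K, and let (λ_i)_{i≥1} be nonnegative reals with Σ_{i=1}^∞ λ_i = ∞. Set s_j = Σ_{i=1}^j λ_i v_i. Then s_j ≠ 0 for all sufficiently large j, and every cluster point of the sequence (s_j/‖s_j‖) belongs to K. -/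
open Filter Topology

/-- A closed convex pointed cone admits a continuous linear functional bounded below on it by a
positive multiple of the norm. -/
theorem exists_dual_mul_norm_le_of_pointed_cone {E : Type*} [NormedAddCommGroup E]
    [NormedSpace ℝ E] [FiniteDimensional ℝ E] {K : Set E} (hKcl : IsClosed K)
    (hKcv : Convex ℝ K) (hKcone : ∀ v ∈ K, ∀ t : ℝ, 0 ≤ t → t • v ∈ K)
    (hKpointed : ∀ v ∈ K, -v ∈ K → v = 0) :
    ∃ (f : StrongDual ℝ E) (c : ℝ), 0 < c ∧ ∀ x ∈ K, c * ‖x‖ ≤ f x := by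
  have : ProperSpace E := FiniteDimensional.proper ℝ E
  have separating : ∀ x ∈ K ∩ Metric.sphere 0 1,
      ∃ f : StrongDual ℝ E, (∀ y ∈ K, 0 ≤ f y) ∧ 0 < f x := by
    rintro x ⟨hx, hx1⟩
    have hx0 : x ≠ 0 := by
      rintro rfl
      simp at hx1
    have hneg : -x ∉ K := fun h => hx0 (hKpointed x hx h)
    obtain ⟨f, u, hfu, hu⟩ := geometric_hahn_banach_point_closed hKcv hKcl hneg
    have hu0 : u < 0 := by
      simpa using hu 0 (by simpa using hKcone x hx 0 le_rfl)
    refine ⟨f, fun y hy => ?_, ?_⟩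
    · by_contra! hfy
      have := hu _ (hKcone y hy (u / f y) (div_nonneg_of_nonpos hu0.le hfy.le))
      rw [map_smul, smul_eq_mul, div_mul_cancel₀ _ hfy.ne] at this
      exact this.false
    · rw [map_neg] at hfu
      linarith
  have hcompact : IsCompact (K ∩ Metric.sphere 0 1) :=
    (isCompact_sphere 0 1).inter_left hKcl
  choose! F hF_nonneg hF_pos using separating
  obtain ⟨t, htS, ht⟩ := hcompact.elim_nhds_subcover (fun x => {y | 0 < F x y})
    fun x hx => (isOpen_lt continuous_const (F x).continuous).mem_nhds (hF_pos x hx)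
  have hpos : ∀ y ∈ K ∩ Metric.sphere 0 1, 0 < (∑ x ∈ t, F x) y := by
    intro y hy
    obtain ⟨x, hxt, hxy⟩ := Set.mem_iUnion₂.1 (ht hy)
    rw [sum_apply]
    exact Finset.sum_pos' (fun z hz => hF_nonneg z (htS z hz) y hy.1) ⟨x, hxt, hxy⟩
  obtain ⟨c, hc, hcf⟩ := hcompact.exists_forall_le' (∑ x ∈ t, F x).continuous.continuousOn hpos
  refine ⟨∑ x ∈ t, F x, c, hc, fun x hx => ?_⟩
  rcases eq_or_ne x 0 with rfl | hx0
  · simp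
  have hxn : 0 < ‖x‖ := norm_pos_iff.2 hx0
  have h := hcf (‖x‖⁻¹ • x)
    ⟨hKcone x hx _ (inv_nonneg.2 hxn.le), by simp [norm_smul, hxn.ne']⟩
  rw [map_smul, smul_eq_mul, inv_mul_eq_div, le_div_iff₀ hxn] at h
  exact h

/-- A sequence in a compact set whose subsequential limits all lie in `K` approaches `K`. -/
theorem IsCompact.tendsto_infDist_zero_of_subseq_limits_mem {E : Type*} [PseudoMetricSpace E]
    {S K : Set E} (hS : IsCompact S) {v : ℕ → E} (hv : ∀ i, v i ∈ S)
    (hvK : ∀ w, (∃ φ : ℕ → ℕ, StrictMono φ ∧ Tendsto (fun k => v (φ k)) atTop (𝓝 w)) → w ∈ K) :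
    Tendsto (fun i => Metric.infDist (v i) K) atTop (𝓝 0) := by
  refine tendsto_of_subseq_tendsto fun ns hns => ?_
  obtain ⟨φ, -, hφ⟩ := strictMono_subseq_of_tendsto_atTop hns
  obtain ⟨w, -, ψ, hψ, hw⟩ := hS.tendsto_subseq (x := v ∘ ns ∘ φ) fun i => hv _
  refine ⟨φ ∘ ψ, ?_⟩
  have hwK : w ∈ K := hvK w ⟨(ns ∘ φ) ∘ ψ, hφ.comp hψ, hw⟩
  simpa [Metric.infDist_zero_of_mem hwK, Function.comp_def] using
    ((Metric.continuous_infDist_pt K).tendsto w).comp hw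

/-- (Proposition 5.7(1), Limit estimates involving pointed cones.)
If the cluster points of unit vectors `v_i` lie in a closed pointed convex cone `K`
and `Σ λ_i = ∞` with `λ_i ≥ 0`, then the partial sums `s_j = Σ_{i<j} λ_i v_i` are
eventually nonzero and every cluster point of `s_j / ‖s_j‖` lies in `K`. -/
theorem normalized_partial_sums_cluster_in_cone
    {n : ℕ}
    (K : Set (EuclideanSpace ℝ (Fin n)))
    (hKcl : IsClosed K) (hKcv : Convex ℝ K)
    (hKcone : ∀ v ∈ K, ∀ t : ℝ, 0 ≤ t → t • v ∈ K)
    (hKpointed : ∀ v ∈ K, -v ∈ K → v = 0)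
    (v : ℕ → EuclideanSpace ℝ (Fin n)) (hv : ∀ i, ‖v i‖ = 1)
    (hvK : ∀ w : EuclideanSpace ℝ (Fin n),
      (∃ ik : ℕ → ℕ, StrictMono ik ∧ Tendsto (fun k => v (ik k)) atTop (𝓝 w)) →
      w ∈ K)
    (lam : ℕ → ℝ) (hlam : ∀ i, 0 ≤ lam i)
    (hdiv : Tendsto (fun j => ∑ i ∈ Finset.range j, lam i) atTop atTop) :
    (∃ J : ℕ, ∀ j ≥ J, (∑ i ∈ Finset.range j, lam i • v i) ≠ 0) ∧
    ∀ w : EuclideanSpace ℝ (Fin n),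
      (∃ jk : ℕ → ℕ, StrictMono jk ∧
        Tendsto (fun k => (‖∑ i ∈ Finset.range (jk k), lam i • v i‖)⁻¹ •
          ∑ i ∈ Finset.range (jk k), lam i • v i) atTop (𝓝 w)) →
      w ∈ K := by
  obtain ⟨f, c, hc, hfc⟩ :=
    exists_dual_mul_norm_le_of_pointed_cone hKcl hKcv hKcone hKpointed
  have hsphere : IsCompact (Metric.sphere (0 : EuclideanSpace ℝ (Fin n)) 1) :=
    isCompact_sphere 0 1
  have hvS : ∀ i, v i ∈ Metric.sphere (0 : EuclideanSpace ℝ (Fin n)) 1 := by simpa using hv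
  have hne : K.Nonempty := by
    obtain ⟨w, -, φ, hφ, hw⟩ := hsphere.tendsto_subseq hvS
    exact ⟨w, hvK w ⟨φ, hφ, hw⟩⟩
  have hzero : (0 : EuclideanSpace ℝ (Fin n)) ∈ K := by
    obtain ⟨x, hx⟩ := hne
    simpa using hKcone x hx 0 le_rfl
  have hadd : ∀ x ∈ K, ∀ y ∈ K, x + y ∈ K := by
    intro x hx y hy
    have h := hKcone _ (hKcv hx hy (a := 1 / 2) (b := 1 / 2) (by norm_num) (by norm_num)
      (by norm_num)) 2 (by norm_num)
    simpa [smul_add, smul_smul] using h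
  have hsum : ∀ (x : ℕ → EuclideanSpace ℝ (Fin n)), (∀ i, x i ∈ K) →
      ∀ j, ∑ i ∈ Finset.range j, x i ∈ K := by
    intro x hx j
    induction j with
    | zero => simpa using hzero
    | succ j ih => rw [Finset.sum_range_succ]; exact hadd _ ih _ (hx j)
  choose q hqK hq using fun i => hKcl.exists_infDist_eq_dist hne (v i)
  have hdist : Tendsto (fun i => ‖v i - q i‖) atTop (𝓝 0) := by
    simpa only [hq, dist_eq_norm] using
      hsphere.tendsto_infDist_zero_of_subseq_limits_mem hvS hvK
  set L : ℕ → ℝ := fun j => ∑ i ∈ Finset.range j, lam i with hL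
  set R : ℕ → ℝ := fun j => ∑ i ∈ Finset.range j, lam i * ‖v i - q i‖ with hR
  set s : ℕ → EuclideanSpace ℝ (Fin n) := fun j => ∑ i ∈ Finset.range j, lam i • v i with hs
  set p : ℕ → EuclideanSpace ℝ (Fin n) := fun j => ∑ i ∈ Finset.range j, lam i • q i with hp
  have hpK : ∀ j, p j ∈ K := hsum _ fun i => hKcone _ (hqK i) _ (hlam i)
  have hRL : R =o[atTop] L := by
    refine Asymptotics.IsLittleO.sum_range ?_ hlam hdiv
    simpa using (Asymptotics.isBigO_refl lam atTop).mul_isLittleO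
      ((Asymptotics.isLittleO_one_iff ℝ).2 hdist)
  have hsp : ∀ j, ‖s j - p j‖ ≤ R j := by
    intro j
    simp only [hs, hp, hR, ← Finset.sum_sub_distrib, ← smul_sub]
    refine norm_sum_le_of_le _ fun i _ => ?_
    rw [norm_smul, Real.norm_of_nonneg (hlam i)]
  have hR0 : ∀ j, 0 ≤ R j := fun j => (norm_nonneg _).trans (hsp j)
  have hfp : ∀ j, c * (L j - R j) ≤ f (p j) := by
    intro j
    simp only [hL, hR, hp, map_sum, ← Finset.sum_sub_distrib, Finset.mul_sum]
    refine Finset.sum_le_sum fun i _ => ?_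
    have h1 : 1 - ‖v i - q i‖ ≤ ‖q i‖ := by
      have := norm_sub_norm_le (v i) (q i)
      rw [hv i] at this
      linarith
    have h2 := (mul_le_mul_of_nonneg_left h1 hc.le).trans (hfc _ (hqK i))
    rw [map_smul, smul_eq_mul]
    linarith [mul_le_mul_of_nonneg_left h2 (hlam i)]
  have hlower : ∀ᶠ j in atTop, c / 2 * L j ≤ ‖f‖ * ‖s j‖ := by
    have hd : 0 < c + ‖f‖ := by positivity
    filter_upwards [hRL.bound (div_pos (half_pos hc) hd), hdiv.eventually_ge_atTop 0]
      with j hj hLj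
    rw [Real.norm_of_nonneg (hR0 j), Real.norm_of_nonneg hLj, div_mul_eq_mul_div,
      le_div_iff₀ hd] at hj
    have h1 : f (p j) - f (s j) ≤ ‖f‖ * R j := by
      rw [← map_sub]
      refine (le_abs_self _).trans ((f.le_opNorm _).trans ?_)
      rw [norm_sub_rev]
      exact mul_le_mul_of_nonneg_left (hsp j) (norm_nonneg f)
    have h2 : f (s j) ≤ ‖f‖ * ‖s j‖ := (le_abs_self _).trans (f.le_opNorm _)
    linarith [hfp j]
  have hs0 : ∀ᶠ j in atTop, s j ≠ 0 := by
    filter_upwards [hlower, hdiv.eventually_gt_atTop 0] with j hj hLj h0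
    rw [h0, norm_zero, mul_zero] at hj
    exact absurd hj (not_le.2 (mul_pos (half_pos hc) hLj))
  refine ⟨eventually_atTop.1 hs0, ?_⟩
  have hLs : L =O[atTop] s := by
    refine Asymptotics.IsBigO.of_bound (‖f‖ / (c / 2)) ?_
    filter_upwards [hlower, hdiv.eventually_ge_atTop 0] with j hj hLj
    rw [Real.norm_of_nonneg hLj, div_mul_eq_mul_div, le_div_iff₀ (half_pos hc)]
    linarith
  have hdiff : (fun j => s j - p j) =o[atTop] fun j => ‖s j‖ := by
    refine (Asymptotics.IsBigO.of_norm_le (g := R) hsp).trans_isLittleO ?_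
    exact (hRL.trans_isBigO hLs).norm_right
  have herr : Tendsto (fun j => ‖s j‖⁻¹ • (s j - p j)) atTop (𝓝 0) :=
    hdiff.tendsto_inv_smul_nhds_zero
  rintro w ⟨φ, hφ, hw⟩
  refine hKcl.mem_of_tendsto (f := fun k => ‖s (φ k)‖⁻¹ • p (φ k)) (b := atTop) ?_
    (Eventually.of_forall fun k => hKcone _ (hpK _) _ (inv_nonneg.2 (norm_nonneg _)))
  have hlim := hw.sub (herr.comp hφ.tendsto_atTop)
  rw [sub_zero] at hlim
  refine hlim.congr fun k => ?_
  change ‖s (φ k)‖⁻¹ • s (φ k) - ‖s (φ k)‖⁻¹ • (s (φ k) - p (φ k)) = _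
  rw [← smul_sub, sub_sub_cancel]
end

section
/- Let K ⊆ ℝⁿ be a closed convex cone and suppose c > 0 and a unit vector d satisfy ⟪d, v⟫ ≥ c for every unit vector v ∈ K. Let (λ_i)_{i≥1} be nonnegative reals with λ_i > 0 for at least one i, let (v_i)_{i≥1} be unit vectors in ℝⁿ, and let (ṽ_i)_{i≥1} be unit vectors in K with ‖v_i − ṽ_i‖ ≤ ε for all i, where 0 ≤ ε < c. Assume the series s := Σ_{i=1}^∞ λ_i v_i converges. Then Σ_{i=1}^∞ λ_i converges, the series s̃ := Σ_{i=1}^∞ λ_i ṽ_i converges, s ≠ 0, s̃ ≠ 0, and ‖ s/‖s‖ − s̃/‖s̃‖ ‖ ≤ (2/c)·ε. -/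
open scoped RealInnerProductSpace
open Filter Topology

/-- Normalization is Lipschitz away from the origin. -/
theorem norm_normalize_sub_normalize_le {E : Type*} [NormedAddCommGroup E] [NormedSpace ℝ E]
    {x y : E} (hx : x ≠ 0) (hy : y ≠ 0) :
    ‖‖x‖⁻¹ • x - ‖y‖⁻¹ • y‖ ≤ 2 * ‖x - y‖ / ‖y‖ := by
  have hx' : 0 < ‖x‖ := norm_pos_iff.2 hx
  have hy' : 0 < ‖y‖ := norm_pos_iff.2 hy
  have hsplit : ‖x‖⁻¹ • x - ‖y‖⁻¹ • y = (‖x‖⁻¹ - ‖y‖⁻¹) • x + ‖y‖⁻¹ • (x - y) := by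
    rw [sub_smul, smul_sub]; abel
  have hfst : ‖(‖x‖⁻¹ - ‖y‖⁻¹) • x‖ ≤ ‖x - y‖ / ‖y‖ := by
    have heq : ‖(‖x‖⁻¹ - ‖y‖⁻¹) • x‖ = |‖y‖ - ‖x‖| / ‖y‖ := by
      rw [norm_smul, Real.norm_eq_abs, inv_sub_inv hx'.ne' hy'.ne', abs_div, abs_mul,
        abs_of_pos hx', abs_of_pos hy']
      field_simp
    rw [heq, norm_sub_rev x y]
    gcongr
    exact abs_norm_sub_norm_le y x
  have hsnd : ‖‖y‖⁻¹ • (x - y)‖ = ‖x - y‖ / ‖y‖ := by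
    rw [norm_smul, norm_inv, norm_norm, inv_mul_eq_div]
  calc ‖‖x‖⁻¹ • x - ‖y‖⁻¹ • y‖ ≤ ‖x - y‖ / ‖y‖ + ‖x - y‖ / ‖y‖ := by
        rw [hsplit]
        exact (norm_add_le _ _).trans (add_le_add hfst hsnd.le)
    _ = 2 * ‖x - y‖ / ‖y‖ := by ring

/-- A lower bound on `⟪d, w i⟫` passes to nonnegative combinations of the `w i`. -/
theorem mul_sum_le_inner_sum_smul {E : Type*} [NormedAddCommGroup E] [InnerProductSpace ℝ E]
    {ι : Type*} (t : Finset ι) {a : ℝ} {d : E} {w : ι → E} {lam : ι → ℝ}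
    (hlam : ∀ i, 0 ≤ lam i) (hw : ∀ i, a ≤ ⟪d, w i⟫) :
    a * ∑ i ∈ t, lam i ≤ ⟪d, ∑ i ∈ t, lam i • w i⟫ := by
  rw [inner_sum, Finset.mul_sum]
  refine Finset.sum_le_sum fun i _ => ?_
  rw [real_inner_smul_right, mul_comm]
  exact mul_le_mul_of_nonneg_left (hw i) (hlam i)

/-- (Proposition 5.7(2), Limit estimates involving pointed cones.)
If unit vectors `v_i` are `ε`-close to unit vectors `ṽ_i` of a closed convex cone
`K` on which `⟪d, ·⟫ ≥ c > 0` holds for unit vectors, `λ_i ≥ 0` are not all zero,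
`0 ≤ ε < c`, and `s = Σ λ_i v_i` converges, then `Σ λ_i` converges,
`s̃ = Σ λ_i ṽ_i` converges, both sums are nonzero, and the normalizations satisfy
`‖s/‖s‖ − s̃/‖s̃‖‖ ≤ (2/c) ε`. -/
theorem close_series_normalization_estimate
    {n : ℕ}
    (K : Set (EuclideanSpace ℝ (Fin n)))
    (hKcl : IsClosed K)
    (hKadd : ∀ u ∈ K, ∀ v ∈ K, u + v ∈ K)
    (hKsmul : ∀ v ∈ K, ∀ t : ℝ, 0 ≤ t → t • v ∈ K)
    (c : ℝ) (hc : 0 < c)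
    (d : EuclideanSpace ℝ (Fin n)) (hd : ‖d‖ = 1)
    (hdc : ∀ v ∈ K, ‖v‖ = 1 → c ≤ ⟪d, v⟫)
    (lam : ℕ → ℝ) (hlam : ∀ i, 0 ≤ lam i) (hlampos : ∃ i, 0 < lam i)
    (v : ℕ → EuclideanSpace ℝ (Fin n)) (hv : ∀ i, ‖v i‖ = 1)
    (vt : ℕ → EuclideanSpace ℝ (Fin n)) (hvt : ∀ i, vt i ∈ K ∧ ‖vt i‖ = 1)
    (ε : ℝ) (hε : 0 ≤ ε) (hεc : ε < c)
    (hclose : ∀ i, ‖v i - vt i‖ ≤ ε)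
    (s : EuclideanSpace ℝ (Fin n))
    (hs : Tendsto (fun m => ∑ i ∈ Finset.range m, lam i • v i) atTop (𝓝 s)) :
    Summable lam ∧
    ∃ st : EuclideanSpace ℝ (Fin n),
      Tendsto (fun m => ∑ i ∈ Finset.range m, lam i • vt i) atTop (𝓝 st) ∧
      s ≠ 0 ∧ st ≠ 0 ∧
      ‖‖s‖⁻¹ • s - ‖st‖⁻¹ • st‖ ≤ (2 / c) * ε := by
  have hvt_inner : ∀ i, c ≤ ⟪d, vt i⟫ := fun i => hdc _ (hvt i).1 (hvt i).2
  have hv_inner : ∀ i, c - ε ≤ ⟪d, v i⟫ := by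
    intro i
    have hle : ⟪d, vt i - v i⟫ ≤ ε := by
      refine (real_inner_le_norm _ _).trans ?_
      rw [hd, one_mul, norm_sub_rev]
      exact hclose i
    rw [inner_sub_right] at hle
    linarith [hvt_inner i]
  have hgap : 0 < c - ε := sub_pos.2 hεc
  have hs_inner : Tendsto (fun m => ⟪d, ∑ i ∈ Finset.range m, lam i • v i⟫) atTop (𝓝 ⟪d, s⟫) :=
    tendsto_const_nhds.inner hs
  have hsum : Summable lam := by
    obtain ⟨B, hB⟩ := hs_inner.bddAbove_range
    refine summable_of_sum_range_le (c := B / (c - ε)) hlam fun m => ?_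
    rw [le_div_iff₀' hgap]
    exact (mul_sum_le_inner_sum_smul _ hlam hv_inner).trans (hB ⟨m, rfl⟩)
  have hlim := hsum.hasSum.tendsto_sum_nat
  obtain ⟨j, hj⟩ := hlampos
  have hpos : 0 < ∑' i, lam i := hsum.tsum_pos hlam j hj
  have hsum_vt : Summable fun i => lam i • vt i := by
    refine Summable.of_norm_bounded hsum fun i => ?_
    rw [norm_smul, (hvt i).2, mul_one, Real.norm_of_nonneg (hlam i)]
  obtain ⟨st, hst⟩ := hsum_vt
  have hst' := hst.tendsto_sum_nat
  have hs_lower : (c - ε) * ∑' i, lam i ≤ ⟪d, s⟫ :=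
    le_of_tendsto_of_tendsto' (hlim.const_mul _) hs_inner
      fun m => mul_sum_le_inner_sum_smul _ hlam hv_inner
  have hst_lower : c * ∑' i, lam i ≤ ‖st‖ := by
    have hle : c * ∑' i, lam i ≤ ⟪d, st⟫ :=
      le_of_tendsto_of_tendsto' (hlim.const_mul _) (tendsto_const_nhds.inner hst')
        fun m => mul_sum_le_inner_sum_smul _ hlam hvt_inner
    simpa [hd] using hle.trans (real_inner_le_norm d st)
  have hdist : ‖s - st‖ ≤ ε * ∑' i, lam i := by
    refine le_of_tendsto_of_tendsto' (hs.sub hst').norm (hlim.const_mul ε) fun m => ?_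
    rw [← Finset.sum_sub_distrib, Finset.mul_sum]
    refine norm_sum_le_of_le _ fun i _ => ?_
    rw [← smul_sub, norm_smul, Real.norm_of_nonneg (hlam i), mul_comm]
    exact mul_le_mul_of_nonneg_right (hclose i) (hlam i)
  have hs0 : s ≠ 0 := by
    rintro rfl
    rw [inner_zero_right] at hs_lower
    exact (mul_pos hgap hpos).not_ge hs_lower
  have hst_pos : 0 < ‖st‖ := (mul_pos hc hpos).trans_le hst_lower
  have hst0 : st ≠ 0 := norm_pos_iff.1 hst_pos
  refine ⟨hsum, st, hst', hs0, hst0, (norm_normalize_sub_normalize_le hs0 hst0).trans ?_⟩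
  calc 2 * ‖s - st‖ / ‖st‖ ≤ 2 * (ε * ∑' i, lam i) / (c * ∑' i, lam i) := by gcongr
    _ = 2 / c * ε := by field_simp
end
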